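/- arXiv:0810.2754 — 6 statements merged into one kernel-verified Lean document; each statement's English description precedes it below -/
import Mathlib

section
/- Let X=(P,Q,R) be a homogeneous polynomial vector field of degree 2 in ℝ³. Then xP(x,y,z)+yQ(x,y,z)+zR(x,y,z)=0 for all (x,y,z)∈S² if and only if there exist real numbers a₁,…,a₈ such that P = a₁xy+a₂y²+a₃z²+a₄xz+a₅yz, Q = −a₁x²−a₂xy+a₆z²+a₇xz+a₈yz, and R = −a₄x²−a₈y²−(a₅+a₇)xy−a₃xz−a₆yz. -/
open MvPolynomial

/-- A homogeneous polynomial of degree 2 in three variables evaluates as a ternary quadratic form. -/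
theorem exists_eval_eq_of_isHomogeneous_two {P : MvPolynomial (Fin 3) ℝ}
    (hP : P.IsHomogeneous 2) :
    ∃ b1 b2 b3 b4 b5 b6 : ℝ, ∀ x y z : ℝ,
      eval ![x, y, z] P =
        b1 * x ^ 2 + b2 * y ^ 2 + b3 * z ^ 2 + b4 * x * y + b5 * x * z + b6 * y * z := by
  rw [P.as_sum]
  refine Finset.sum_induction _ (fun F : MvPolynomial (Fin 3) ℝ =>
    ∃ b1 b2 b3 b4 b5 b6 : ℝ, ∀ x y z : ℝ, eval ![x, y, z] F =
      b1 * x ^ 2 + b2 * y ^ 2 + b3 * z ^ 2 + b4 * x * y + b5 * x * z + b6 * y * z) ?_ ?_ ?_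
  · rintro F G ⟨b1, b2, b3, b4, b5, b6, hF⟩ ⟨c1, c2, c3, c4, c5, c6, hG⟩
    refine ⟨b1 + c1, b2 + c2, b3 + c3, b4 + c4, b5 + c5, b6 + c6, fun x y z => ?_⟩
    rw [map_add, hF, hG]
    ring
  · exact ⟨0, 0, 0, 0, 0, 0, by simp⟩
  · intro d hd
    have hdeg : d 0 + d 1 + d 2 = 2 := by
      have h : Finsupp.weight (fun _ => 1) d = 2 := hP (mem_support_iff.mp hd)
      rwa [← Finsupp.degree_eq_weight_one, Finsupp.degree_eq_sum, Fin.sum_univ_three] at h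
    have heval : ∀ x y z : ℝ, eval ![x, y, z] (monomial d (coeff d P)) =
        coeff d P * (x ^ d 0 * y ^ d 1 * z ^ d 2) := by
      intro x y z
      rw [eval_monomial, Finsupp.prod_fintype _ _ (by simp), Fin.prod_univ_three]
      simp
    simp only [heval]
    generalize coeff d P = c
    generalize d 0 = i, d 1 = j, d 2 = k at hdeg
    have hcases : (i = 2 ∧ j = 0 ∧ k = 0) ∨ (i = 0 ∧ j = 2 ∧ k = 0) ∨ (i = 0 ∧ j = 0 ∧ k = 2) ∨
        (i = 1 ∧ j = 1 ∧ k = 0) ∨ (i = 1 ∧ j = 0 ∧ k = 1) ∨ (i = 0 ∧ j = 1 ∧ k = 1) := by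
      omega
    rcases hcases with ⟨rfl, rfl, rfl⟩ | ⟨rfl, rfl, rfl⟩ | ⟨rfl, rfl, rfl⟩ | ⟨rfl, rfl, rfl⟩ |
      ⟨rfl, rfl, rfl⟩ | ⟨rfl, rfl, rfl⟩
    · exact ⟨c, 0, 0, 0, 0, 0, fun x y z => by ring⟩
    · exact ⟨0, c, 0, 0, 0, 0, fun x y z => by ring⟩
    · exact ⟨0, 0, c, 0, 0, 0, fun x y z => by ring⟩
    · exact ⟨0, 0, 0, c, 0, 0, fun x y z => by ring⟩
    · exact ⟨0, 0, 0, 0, c, 0, fun x y z => by ring⟩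
    · exact ⟨0, 0, 0, 0, 0, c, fun x y z => by ring⟩

/-- A function on `ℝ³` that is homogeneous of degree 3 and vanishes on the unit sphere vanishes
identically. -/
theorem eq_zero_of_forall_sphere_eq_zero {f : ℝ → ℝ → ℝ → ℝ}
    (hf : ∀ t x y z, f (t * x) (t * y) (t * z) = t ^ 3 * f x y z)
    (h : ∀ x y z : ℝ, x ^ 2 + y ^ 2 + z ^ 2 = 1 → f x y z = 0) (x y z : ℝ) : f x y z = 0 := by
  by_cases h0 : x ^ 2 + y ^ 2 + z ^ 2 = 0
  · obtain ⟨rfl, rfl, rfl⟩ : x = 0 ∧ y = 0 ∧ z = 0 :=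
      ⟨by nlinarith [sq_nonneg x, sq_nonneg y, sq_nonneg z],
        by nlinarith [sq_nonneg x, sq_nonneg y, sq_nonneg z],
        by nlinarith [sq_nonneg x, sq_nonneg y, sq_nonneg z]⟩
    simpa using hf 0 0 0 0
  · set r := √(x ^ 2 + y ^ 2 + z ^ 2)
    have hr2 : r ^ 2 = x ^ 2 + y ^ 2 + z ^ 2 := Real.sq_sqrt (by positivity)
    have hr : r ≠ 0 := by
      intro hr
      rw [hr] at hr2
      exact h0 (by linarith)
    have hs := h (r⁻¹ * x) (r⁻¹ * y) (r⁻¹ * z) (by field_simp; linarith)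
    rw [hf] at hs
    exact (mul_eq_zero.mp hs).resolve_left (pow_ne_zero _ (inv_ne_zero hr))

/-- A homogeneous polynomial vector field `X = (P,Q,R)` of degree 2 in `ℝ³`
satisfies `xP + yQ + zR = 0` on the sphere `S²` if and only if it has the normal form (★). -/
theorem stmt0 (P Q R : MvPolynomial (Fin 3) ℝ)
    (hP : P.IsHomogeneous 2) (hQ : Q.IsHomogeneous 2) (hR : R.IsHomogeneous 2) :
    (∀ x y z : ℝ, x ^ 2 + y ^ 2 + z ^ 2 = 1 →
        x * eval ![x, y, z] P + y * eval ![x, y, z] Q + z * eval ![x, y, z] R = 0) ↔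
    (∃ a1 a2 a3 a4 a5 a6 a7 a8 : ℝ, ∀ x y z : ℝ,
        eval ![x, y, z] P = a1 * x * y + a2 * y ^ 2 + a3 * z ^ 2 + a4 * x * z + a5 * y * z ∧
        eval ![x, y, z] Q = -a1 * x ^ 2 - a2 * x * y + a6 * z ^ 2 + a7 * x * z + a8 * y * z ∧
        eval ![x, y, z] R = -a4 * x ^ 2 - a8 * y ^ 2 - (a5 + a7) * x * y
            - a3 * x * z - a6 * y * z) := by
  obtain ⟨p1, p2, p3, p4, p5, p6, hp⟩ := exists_eval_eq_of_isHomogeneous_two hP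
  obtain ⟨q1, q2, q3, q4, q5, q6, hq⟩ := exists_eval_eq_of_isHomogeneous_two hQ
  obtain ⟨r1, r2, r3, r4, r5, r6, hr⟩ := exists_eval_eq_of_isHomogeneous_two hR
  constructor
  · intro h
    have h' := eq_zero_of_forall_sphere_eq_zero (f := fun x y z =>
      x * eval ![x, y, z] P + y * eval ![x, y, z] Q + z * eval ![x, y, z] R)
      (fun t x y z => by simp only [hp, hq, hr]; ring) h
    simp only [hp, hq, hr] at h' ⊢
    have e1 := h' 1 0 0
    have e2 := h' 0 1 0
    have e3 := h' 0 0 1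
    have e4 := h' 1 1 0
    have e5 := h' 1 (-1) 0
    have e6 := h' 1 0 1
    have e7 := h' 1 0 (-1)
    have e8 := h' 0 1 1
    have e9 := h' 0 1 (-1)
    have e10 := h' 1 1 1
    ring_nf at e1 e2 e3 e4 e5 e6 e7 e8 e9 e10
    obtain rfl : p1 = 0 := by linarith
    obtain rfl : q2 = 0 := by linarith
    obtain rfl : r3 = 0 := by linarith
    obtain rfl : q1 = -p4 := by linarith
    obtain rfl : q4 = -p2 := by linarith
    obtain rfl : r1 = -p5 := by linarith
    obtain rfl : r5 = -p3 := by linarith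
    obtain rfl : r2 = -q6 := by linarith
    obtain rfl : r6 = -q3 := by linarith
    obtain rfl : r4 = -(p6 + q5) := by linarith
    exact ⟨p4, p2, p3, p5, p6, q3, q5, q6, fun x y z => ⟨by ring, by ring, by ring⟩⟩
  · rintro ⟨a1, a2, a3, a4, a5, a6, a7, a8, h⟩ x y z -
    obtain ⟨h1, h2, h3⟩ := h x y z
    rw [h1, h2, h3]
    ring
end

section
/- Let X be a homogeneous polynomial vector field on S² of degree 2 whose associated system is the normal form (★) with a₃ = a₆ = 0, so that p=(0,0,−1) is a singularity of X. Then p is a center of X if and only if a₈ = −a₄, a₄² + a₇a₅ < 0, and a₄(a₁²−a₂²) + a₁a₂(a₅+a₇) = 0. -/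
/-- The planar system (†) obtained by central projection at `(0,0,-1)` of the normal form (★)
with `a₃ = a₆ = 0`. -/
def sysDagger (a1 a2 a4 a5 a7 a8 : ℝ) : ℝ × ℝ → ℝ × ℝ := fun w =>
  (-a4 * w.1 - a5 * w.2 + a1 * w.1 * w.2 + a2 * w.2 ^ 2 - a4 * w.1 ^ 3
      - (a5 + a7) * w.1 ^ 2 * w.2 - a8 * w.1 * w.2 ^ 2,
   -a7 * w.1 - a8 * w.2 - a1 * w.1 ^ 2 - a2 * w.1 * w.2 - a4 * w.1 ^ 2 * w.2
      - (a5 + a7) * w.1 * w.2 ^ 2 - a8 * w.2 ^ 3)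

/-- A singular point `q` of a planar vector field `f` is a center if it has a punctured
neighborhood in which every orbit is a (nonconstant) periodic orbit surrounding `q`
(i.e. `q` lies in a bounded component of the complement of the orbit). -/
def IsCenter (f : ℝ × ℝ → ℝ × ℝ) (q : ℝ × ℝ) : Prop :=
  f q = 0 ∧ ∃ U ∈ nhds q, ∀ p ∈ U, p ≠ q →
    ∃ (γ : ℝ → ℝ × ℝ) (T : ℝ),
      γ 0 = p ∧ (∀ t, HasDerivAt γ (f (γ t)) t) ∧ 0 < T ∧ (∀ t, γ (t + T) = γ t) ∧
      (¬ ∀ t, γ t = γ 0) ∧ q ∉ Set.range γ ∧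
      Bornology.IsBounded (connectedComponentIn (Set.range γ)ᶜ q)

open Set Filter Topology

/-- A globally defined integral curve of the autonomous vector field `f`. -/
def IsSolution (f : ℝ × ℝ → ℝ × ℝ) (γ : ℝ → ℝ × ℝ) : Prop :=
  ∀ t, HasDerivAt γ (f (γ t)) t

/-- `V'` is the derivative of `V` along the solutions of `f`. -/
def HasLieDeriv (f : ℝ × ℝ → ℝ × ℝ) (V V' : ℝ × ℝ → ℝ) : Prop :=
  ∀ γ, IsSolution f γ → ∀ t, HasDerivAt (fun s => V (γ s)) (V' (γ t)) t

theorem IsSolution.continuous {f : ℝ × ℝ → ℝ × ℝ} {γ : ℝ → ℝ × ℝ} (h : IsSolution f γ) :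
    Continuous γ :=
  continuous_iff_continuousAt.2 fun t => (h t).continuousAt

theorem IsSolution.fst {f : ℝ × ℝ → ℝ × ℝ} {γ : ℝ → ℝ × ℝ} (h : IsSolution f γ) (t : ℝ) :
    HasDerivAt (fun s => (γ s).1) (f (γ t)).1 t := by
  simpa [Function.comp_def] using (hasFDerivAt_fst (𝕜 := ℝ) (p := γ t)).comp_hasDerivAt t (h t)

theorem IsSolution.snd {f : ℝ × ℝ → ℝ × ℝ} {γ : ℝ → ℝ × ℝ} (h : IsSolution f γ) (t : ℝ) :
    HasDerivAt (fun s => (γ s).2) (f (γ t)).2 t := by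
  simpa [Function.comp_def] using (hasFDerivAt_snd (𝕜 := ℝ) (p := γ t)).comp_hasDerivAt t (h t)

theorem IsCenter.exists_periodic {f : ℝ × ℝ → ℝ × ℝ} {q : ℝ × ℝ} (h : IsCenter f q) :
    ∃ U ∈ 𝓝 q, ∀ p ∈ U, p ≠ q → ∃ (γ : ℝ → ℝ × ℝ) (T : ℝ), γ 0 = p ∧ IsSolution f γ ∧ 0 < T ∧
      γ T = γ 0 ∧ (¬ ∀ t, γ t = γ 0) ∧ ∀ t, γ t ≠ q := by
  obtain ⟨-, U, hU, H⟩ := h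
  refine ⟨U, hU, fun p hp hpq => ?_⟩
  obtain ⟨γ, T, h0, hsol, hT, hper, hnc, hq, -⟩ := H p hp hpq
  exact ⟨γ, T, h0, hsol, hT, by simpa using hper 0, hnc, fun t ht => hq ⟨t, ht⟩⟩

theorem exists_first_exit {X : Type*} [TopologicalSpace X] {γ : ℝ → X} (hγ : Continuous γ)
    {O : Set X} (hO : IsOpen O) (h : ∃ t, 0 ≤ t ∧ γ t ∉ O) :
    ∃ t, 0 ≤ t ∧ γ t ∉ O ∧ ∀ s ∈ Ico 0 t, γ s ∈ O := by
  have hc : IsClosed {t : ℝ | 0 ≤ t ∧ γ t ∉ O} :=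
    (isClosed_le continuous_const continuous_id).inter (hO.isClosed_compl.preimage hγ)
  have hb : BddBelow {t : ℝ | 0 ≤ t ∧ γ t ∉ O} := ⟨0, fun t ht => ht.1⟩
  have hm := hc.csInf_mem h hb
  refine ⟨_, hm.1, hm.2, fun s hs => ?_⟩
  by_contra hsO
  exact absurd (csInf_le hb ⟨hs.1, hsO⟩) (not_le.2 hs.2)

/-- A function with negative derivative on `(a, b)` takes a smaller value at `b` than at `a`. -/
theorem lt_of_hasDerivAt_neg {g g' : ℝ → ℝ} (hg : ∀ t, HasDerivAt g (g' t) t) {a b : ℝ}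
    (hab : a < b) (hneg : ∀ t ∈ Ioo a b, g' t < 0) : g b < g a := by
  have hc : Continuous g := continuous_iff_continuousAt.2 fun t => (hg t).continuousAt
  refine strictAntiOn_of_deriv_neg (convex_Icc a b) hc.continuousOn (fun t ht => ?_)
    (left_mem_Icc.2 hab.le) (right_mem_Icc.2 hab.le) hab
  rw [interior_Icc] at ht
  rw [(hg t).deriv]
  exact hneg t ht

/-- Finite-time continuous dependence on initial conditions for `C¹` planar vector fields. -/
theorem IsSolution.exists_delta {f : ℝ × ℝ → ℝ × ℝ} (hf : ContDiff ℝ 1 f) {γ : ℝ → ℝ × ℝ}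
    (hγ : IsSolution f γ) {t₀ : ℝ} {ε : ℝ} (hε : 0 < ε) :
    ∃ δ > 0, ∀ η, IsSolution f η → dist (η 0) (γ 0) < δ →
      ∀ t ∈ Icc 0 t₀, dist (η t) (γ t) < ε := by
  have hcomp : IsCompact (Metric.cthickening ε (γ '' Icc 0 t₀)) :=
    (isCompact_Icc.image hγ.continuous).cthickening
  obtain ⟨K, hK⟩ := (hf.locallyLipschitz.locallyLipschitzOn
    (s := Metric.cthickening ε (γ '' Icc 0 t₀))).exists_lipschitzOnWith_of_compact hcomp
  refine ⟨ε * Real.exp (-(K * |t₀|)), by positivity, fun η hη h0 => ?_⟩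
  by_contra! hcon
  obtain ⟨t₂, ht₂, hd₂⟩ := hcon
  obtain ⟨t₁, ht₁, hd₁, hlt⟩ := exists_first_exit
    (γ := fun t => dist (η t) (γ t)) (hη.continuous.dist hγ.continuous) (isOpen_Iio (a := ε))
    ⟨t₂, ht₂.1, not_lt.2 hd₂⟩
  have ht₁₂ : t₁ ≤ t₂ := by
    by_contra! hh
    exact absurd (hlt t₂ ⟨ht₂.1, hh⟩) (not_lt.2 hd₂)
  have hmem : ∀ t ∈ Ico 0 t₁, γ t ∈ γ '' Icc 0 t₀ := fun t ht =>
    ⟨t, ⟨ht.1, ht.2.le.trans (ht₁₂.trans ht₂.2)⟩, rfl⟩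
  have key := dist_le_of_trajectories_ODE_of_mem (v := fun _ => f)
    (s := fun _ => Metric.cthickening ε (γ '' Icc 0 t₀)) (a := 0) (b := t₁) (fun _ _ => hK)
    hη.continuous.continuousOn (fun t _ => (hη t).hasDerivWithinAt)
    (fun t ht => Metric.mem_cthickening_of_dist_le _ _ _ _ (hmem t ht) (le_of_lt (hlt t ht)))
    hγ.continuous.continuousOn (fun t _ => (hγ t).hasDerivWithinAt)
    (fun t ht => Metric.self_subset_cthickening _ (hmem t ht)) le_rfl t₁ ⟨ht₁, le_rfl⟩
  have hK0 : (K : ℝ) * (t₁ - 0) ≤ K * |t₀| := by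
    refine mul_le_mul_of_nonneg_left ?_ K.2
    linarith [ht₁₂.trans ht₂.2, le_abs_self t₀]
  have h2 : dist (η 0) (γ 0) * Real.exp (K * (t₁ - 0)) < ε := by
    calc dist (η 0) (γ 0) * Real.exp (K * (t₁ - 0))
        ≤ dist (η 0) (γ 0) * Real.exp (K * |t₀|) := by gcongr
      _ < ε * Real.exp (-(K * |t₀|)) * Real.exp (K * |t₀|) := by gcongr
      _ = ε := by rw [mul_assoc, ← Real.exp_add]; simp
  exact hd₁ (key.trans_lt h2)

theorem IsSolution.eq_const {f : ℝ × ℝ → ℝ × ℝ} (hf : ContDiff ℝ 1 f) {γ : ℝ → ℝ × ℝ}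
    (hγ : IsSolution f γ) (h0 : f (γ 0) = 0) {t : ℝ} (ht : 0 ≤ t) : γ t = γ 0 := by
  by_contra hne
  have hconst : IsSolution f (fun _ => γ 0) := fun s => by
    simpa [h0] using hasDerivAt_const s (γ 0)
  obtain ⟨δ, hδ, H⟩ := hconst.exists_delta hf (t₀ := t) (dist_pos.2 hne)
  exact lt_irrefl _ (H γ hγ (by simpa using hδ) t ⟨ht, le_rfl⟩)

/-- Time reversal. -/
theorem IsSolution.reverse {f : ℝ × ℝ → ℝ × ℝ} {γ : ℝ → ℝ × ℝ} (h : IsSolution f γ) :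
    IsSolution (fun w => -f w) (fun t => γ (-t)) := fun t => by
  simpa [Function.comp_def] using (h (-t)).scomp t (hasDerivAt_neg t)

theorem IsCenter.neg {f : ℝ × ℝ → ℝ × ℝ} {q : ℝ × ℝ} (h : IsCenter f q) :
    IsCenter (fun w => -f w) q := by
  obtain ⟨hq, U, hU, H⟩ := h
  refine ⟨by simp [hq], U, hU, fun p hp hpq => ?_⟩
  obtain ⟨γ, T, h0, hsol, hT, hper, hnc, hr, hb⟩ := H p hp hpq
  have hrange : range (fun t => γ (-t)) = range γ := (Equiv.neg ℝ).surjective.range_comp γ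
  refine ⟨fun t => γ (-t), T, by simpa using h0, IsSolution.reverse hsol, hT, fun t => ?_,
    fun hc => hnc fun t => by simpa using hc (-t), by rwa [hrange], by rwa [hrange]⟩
  have := hper (-(t + T))
  rw [show -(t + T) + T = -t by ring] at this
  exact this.symm

/-- A singular point that is an accumulation point of singular points is not a center. -/
theorem IsCenter.eventually_ne_zero {f : ℝ × ℝ → ℝ × ℝ} (hf : ContDiff ℝ 1 f) {q : ℝ × ℝ}
    (h : IsCenter f q) : ∀ᶠ w in 𝓝 q, w ≠ q → f w ≠ 0 := by
  obtain ⟨U, hU, H⟩ := h.exists_periodic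
  filter_upwards [hU] with p hp hpq h0
  obtain ⟨γ, T, rfl, hsol, -, -, hnc, -⟩ := H p hp hpq
  refine hnc fun t => ?_
  rcases le_total 0 t with ht | ht
  · exact hsol.eq_const hf h0 ht
  · simpa using (IsSolution.reverse hsol).eq_const (hf.neg) (by simpa using h0) (neg_nonneg.2 ht)

/-- A strict Lyapunov function excludes a center. -/
theorem not_isCenter_of_lyapunov {f : ℝ × ℝ → ℝ × ℝ} {V V' : ℝ × ℝ → ℝ} (hV : Continuous V)
    (hV0 : V 0 = 0) (hL : HasLieDeriv f V V')
    (hpos : ∀ᶠ w in 𝓝 (0 : ℝ × ℝ), w ≠ 0 → 0 < V w)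
    (hneg : ∀ᶠ w in 𝓝 (0 : ℝ × ℝ), w ≠ 0 → V' w < 0) : ¬ IsCenter f 0 := by
  intro hc
  obtain ⟨U, hU, H⟩ := hc.exists_periodic
  obtain ⟨r, hr, hball⟩ := Metric.nhds_basis_closedBall.eventually_iff.1 (hpos.and hneg)
  obtain ⟨m, hm, hmin⟩ : ∃ m > 0, ∀ w ∈ Metric.sphere (0 : ℝ × ℝ) r, m ≤ V w := by
    obtain ⟨w, hw, hmin⟩ := (isCompact_sphere (0 : ℝ × ℝ) r).exists_isMinOn
      (NormedSpace.sphere_nonempty.2 hr.le) hV.continuousOn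
    refine ⟨V w, (hball (Metric.sphere_subset_closedBall hw)).1 ?_, fun x hx => hmin hx⟩
    rintro rfl
    simp at hw
    exact hr.ne hw
  have hsmall : ∀ᶠ w in 𝓝 (0 : ℝ × ℝ), V w < m ∧ w ∈ U ∧ w ∈ Metric.ball 0 r :=
    ((hV.tendsto 0).eventually (gt_mem_nhds (by rwa [hV0]))).and
      (Filter.Eventually.and hU (Metric.ball_mem_nhds _ hr))
  obtain ⟨p, ⟨hpV, hpU, hpr⟩, hp0⟩ :=
    ((hsmall.filter_mono nhdsWithin_le_nhds).and (self_mem_nhdsWithin (s := {0}ᶜ))).exists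
  obtain ⟨γ, T, rfl, hsol, hT, hTp, -, hne⟩ := H p hpU hp0
  have hstay : ∀ t, 0 ≤ t → γ t ∈ Metric.ball 0 r := by
    by_contra! hcon
    obtain ⟨t, ht, hout, hin⟩ := exists_first_exit hsol.continuous Metric.isOpen_ball hcon
    have ht0 : 0 < t := ht.lt_of_ne (by rintro rfl; exact hout hpr)
    have hlt := lt_of_hasDerivAt_neg (hL γ hsol) ht0 fun s hs =>
      (hball (Metric.ball_subset_closedBall (hin s ⟨hs.1.le, hs.2⟩))).2 (hne s)
    have hcl : γ t ∈ Metric.closedBall 0 r := by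
      have : t ∈ closure (Ico 0 t) := by
        rw [closure_Ico ht0.ne]; exact ⟨ht, le_rfl⟩
      refine Metric.closure_ball_subset_closedBall
        ((map_mem_closure hsol.continuous this) fun s hs => hin s hs)
    have hsph : γ t ∈ Metric.sphere 0 r := by
      rw [Metric.mem_sphere]
      exact le_antisymm hcl (not_lt.1 hout)
    linarith [hmin _ hsph]
  have := lt_of_hasDerivAt_neg (hL γ hsol) hT fun s hs =>
      (hball (Metric.ball_subset_closedBall (hstay s hs.1.le))).2 (hne s)
  rw [hTp] at this
  exact lt_irrefl _ this

theorem HasLieDeriv.reverse {f : ℝ × ℝ → ℝ × ℝ} {V V' : ℝ × ℝ → ℝ} (h : HasLieDeriv f V V') :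
    HasLieDeriv (fun w => -f w) V (fun w => -V' w) := by
  intro γ hγ t
  have h2 : IsSolution f (fun t => γ (-t)) := by simpa using hγ.reverse
  have h3 := h _ h2 (-t)
  have h4 := h3.comp t (hasDerivAt_neg t)
  simpa [Function.comp_def] using h4

/-- A Lyapunov function with derivative of either strict sign excludes a center. -/
theorem not_isCenter_of_lyapunov_sign {f : ℝ × ℝ → ℝ × ℝ} {V V' : ℝ × ℝ → ℝ} (hV : Continuous V)
    (hV0 : V 0 = 0) (hL : HasLieDeriv f V V')
    (hpos : ∀ᶠ w in 𝓝 (0 : ℝ × ℝ), w ≠ 0 → 0 < V w) {κ : ℝ}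
    (hsign : ∀ᶠ w in 𝓝 (0 : ℝ × ℝ), w ≠ 0 → 0 < κ * V' w) : ¬ IsCenter f 0 := by
  rcases lt_or_ge κ 0 with hκ | hκ
  · refine not_isCenter_of_lyapunov hV hV0 hL hpos ?_
    filter_upwards [hsign] with w hw h0
    nlinarith [hw h0]
  · intro hc
    refine not_isCenter_of_lyapunov hV hV0 hL.reverse hpos ?_ hc.neg
    filter_upwards [hsign] with w hw h0
    nlinarith [hw h0]

/-- Escape through one of two walls: the solution crosses `A = 0` while `B < 0`. -/
theorem exists_crossing {A A' B : ℝ × ℝ → ℝ} {f : ℝ × ℝ → ℝ × ℝ} (hB : Continuous B)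
    (hLA : HasLieDeriv f A A') {γ : ℝ → ℝ × ℝ} (hγ : IsSolution f γ) {t : ℝ} (ht : 0 ≤ t)
    (hA0 : A (γ t) = 0) (hA' : 0 < A' (γ t)) (hBneg : ∀ s ∈ Icc 0 t, B (γ s) < 0) :
    ∃ t, 0 ≤ t ∧ 0 < A (γ t) ∧ ∀ s ∈ Icc 0 t, B (γ s) < 0 := by
  have h1 : ∀ᶠ s in 𝓝[>] t, 0 < A (γ s) := by
    have := (hLA γ hγ t).hasDerivWithinAt (s := Ioi t)
    have h2 := (hasDerivWithinAt_iff_tendsto_slope' (self_notMem_Ioi)).1 this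
    filter_upwards [h2.eventually (lt_mem_nhds hA'), self_mem_nhdsWithin] with s hs hst
    rw [slope_def_field, hA0, sub_zero] at hs
    exact (div_pos_iff_of_pos_right (sub_pos.2 hst)).1 hs
  have h3 : ∀ᶠ s in 𝓝 t, B (γ s) < 0 :=
    (hB.comp hγ.continuous).continuousAt.eventually (gt_mem_nhds (hBneg t ⟨ht, le_rfl⟩))
  obtain ⟨ε, hε, hball⟩ := Metric.eventually_nhds_iff.1 h3
  obtain ⟨s, hs, hst⟩ := (h1.and (Ioo_mem_nhdsGT (show t < t + ε by linarith))).exists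
  refine ⟨s, ht.trans hst.1.le, hs, fun x hx => ?_⟩
  rcases le_or_gt x t with h | h
  · exact hBneg x ⟨hx.1, h⟩
  · refine hball ?_
    rw [Real.dist_eq, abs_lt]
    constructor <;> linarith [hx.2, hst.2]

/-- The set of parameters of solutions crossing `A = 0` while `B < 0` is open. -/
theorem eventually_crossing {A B : ℝ × ℝ → ℝ} {f : ℝ × ℝ → ℝ × ℝ} (hf : ContDiff ℝ 1 f)
    (hA : Continuous A) (hB : Continuous B) {γ : ℝ → ℝ × ℝ} (hγ : IsSolution f γ)
    (h : ∃ t, 0 ≤ t ∧ 0 < A (γ t) ∧ ∀ s ∈ Icc 0 t, B (γ s) < 0) :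
    ∃ δ > 0, ∀ η, IsSolution f η → dist (η 0) (γ 0) < δ →
      ∃ t, 0 ≤ t ∧ 0 < A (η t) ∧ ∀ s ∈ Icc 0 t, B (η s) < 0 := by
  obtain ⟨t, ht, hAt, hBt⟩ := h
  obtain ⟨ε₁, hε₁, h₁⟩ := Metric.eventually_nhds_iff.1
    (hA.continuousAt.eventually (lt_mem_nhds hAt))
  obtain ⟨ε₂, hε₂, h₂⟩ := ((isCompact_Icc (a := 0) (b := t)).image
    hγ.continuous).exists_thickening_subset_open (hB.isOpen_preimage _ (isOpen_Iio (a := (0 : ℝ))))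
    (by rintro _ ⟨s, hs, rfl⟩; exact hBt s hs)
  obtain ⟨δ, hδ, H⟩ := hγ.exists_delta hf (t₀ := t) (lt_min hε₁ hε₂)
  refine ⟨δ, hδ, fun η hη hd => ⟨t, ht, h₁ ((H η hη hd t ⟨ht, le_rfl⟩).trans_le (min_le_left _ _)),
    fun s hs => h₂ ?_⟩⟩
  exact Metric.mem_thickening_iff.2
    ⟨γ s, mem_image_of_mem γ hs, (H η hη hd s hs).trans_le (min_le_right _ _)⟩

/-- A Ważewski-type criterion: if near the singular point there is a sector `{A ≤ 0, B ≤ 0}` whose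
two sides are crossed outwards while the height `h` decreases inside, then some solution is trapped
in the sector, hence not periodic, and the singular point is not a center. -/
theorem not_isCenter_of_sector {f : ℝ × ℝ → ℝ × ℝ} (hf : ContDiff ℝ 1 f)
    {A A' B B' h h' : ℝ × ℝ → ℝ} (hA : Continuous A) (hB : Continuous B) (hh : Continuous h)
    (hLA : HasLieDeriv f A A') (hLB : HasLieDeriv f B B') (hLh : HasLieDeriv f h h') {δ : ℝ}
    (h0 : h 0 = 0) (hdisj : ∀ w, A w = 0 → B w = 0 → h w ≤ 0)
    (hzero : ∀ w, A w ≤ 0 → B w ≤ 0 → h w = 0 → w = 0)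
    (hA' : ∀ w, A w = 0 → B w ≤ 0 → 0 < h w → h w < δ → 0 < A' w)
    (hB' : ∀ w, A w ≤ 0 → B w = 0 → 0 < h w → h w < δ → 0 < B' w)
    (hh' : ∀ w, A w < 0 → B w < 0 → 0 < h w → h w < δ → h' w < 0)
    (hσ : ∀ U ∈ 𝓝 (0 : ℝ × ℝ), ∃ σ : ℝ → ℝ × ℝ, Continuous σ ∧
      (∀ s ∈ Icc (0 : ℝ) 1, σ s ∈ U ∧ A (σ s) ≤ 0 ∧ B (σ s) ≤ 0 ∧ 0 < h (σ s) ∧ h (σ s) < δ) ∧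
      A (σ 0) = 0 ∧ B (σ 1) = 0) : ¬ IsCenter f 0 := by
  intro hc
  obtain ⟨U, hU, H⟩ := hc.exists_periodic
  obtain ⟨σ, hσc, hσI, hσ0, hσ1⟩ := hσ U hU
  have hσne : ∀ s ∈ Icc (0 : ℝ) 1, σ s ≠ 0 := fun s hs h1 => by
    have := (hσI s hs).2.2.2.1
    rw [h1, h0] at this
    exact lt_irrefl _ this
  choose! γ T hγ0 hsol hT hTp _ hne using fun s : Icc (0 : ℝ) 1 =>
    H (σ s) (hσI s s.2).1 (hσne s s.2)
  have hcross : ∀ s : Icc (0 : ℝ) 1,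
      (∃ t, 0 ≤ t ∧ 0 < A (γ s t) ∧ ∀ x ∈ Icc 0 t, B (γ s x) < 0) ∨
      (∃ t, 0 ≤ t ∧ 0 < B (γ s t) ∧ ∀ x ∈ Icc 0 t, A (γ s x) < 0) := by
    intro s
    obtain ⟨-, hAs, hBs, hhs, hhδ⟩ := hσI s s.2
    rw [← hγ0 s] at hAs hBs hhs hhδ
    have hcont := (hsol s).continuous
    set O : Set (ℝ × ℝ) := {w | A w < 0 ∧ B w < 0 ∧ 0 < h w ∧ h w < δ} with hOdef
    have hO : IsOpen O :=
      (isOpen_lt hA continuous_const).inter ((isOpen_lt hB continuous_const).inter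
        ((isOpen_lt continuous_const hh).inter (isOpen_lt hh continuous_const)))
    have hexit : ∃ t, 0 ≤ t ∧ γ s t ∉ O := by
      by_contra! hin
      have := lt_of_hasDerivAt_neg (hLh _ (hsol s)) (hT s) fun t ht =>
        have hw := hin t ht.1.le
        hh' _ hw.1 hw.2.1 hw.2.2.1 hw.2.2.2
      rw [hTp] at this
      exact lt_irrefl _ this
    obtain ⟨t, ht, hout, hin⟩ := exists_first_exit hcont hO hexit
    obtain ⟨hAt, hBt, hht, htδ⟩ :
        A (γ s t) ≤ 0 ∧ B (γ s t) ≤ 0 ∧ 0 ≤ h (γ s t) ∧ h (γ s t) < δ := by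
      rcases ht.eq_or_lt with rfl | ht0
      · exact ⟨hAs, hBs, hhs.le, hhδ⟩
      · have hcl : t ∈ closure (Ico 0 t) := by
          rw [closure_Ico ht0.ne]; exact ⟨ht, le_rfl⟩
        have hle : γ s t ∈ {w | A w ≤ 0} ∩ ({w | B w ≤ 0} ∩ {w | 0 ≤ h w}) := by
          refine IsClosed.closure_subset ?_ (map_mem_closure hcont hcl fun x hx => ?_)
          · exact (isClosed_le hA continuous_const).inter
              ((isClosed_le hB continuous_const).inter (isClosed_le continuous_const hh))
          · exact ⟨(hin x hx).1.le, (hin x hx).2.1.le, (hin x hx).2.2.1.le⟩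
        refine ⟨hle.1, hle.2.1, hle.2.2, lt_trans ?_ hhδ⟩
        refine lt_of_hasDerivAt_neg (hLh _ (hsol s)) ht0 fun x hx => ?_
        have hw := hin x ⟨hx.1.le, hx.2⟩
        exact hh' _ hw.1 hw.2.1 hw.2.2.1 hw.2.2.2
    have hhpos : 0 < h (γ s t) :=
      hht.lt_of_ne fun he => hne s t (hzero _ hAt hBt he.symm)
    rcases hAt.eq_or_lt with hA0 | hAneg
    · have hBneg : B (γ s t) < 0 := hBt.lt_of_ne fun hB0 => (hdisj _ hA0 hB0).not_gt hhpos
      refine Or.inl (exists_crossing hB hLA (hsol s) ht hA0 (hA' _ hA0 hBt hhpos htδ) ?_)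
      intro x hx
      rcases hx.2.eq_or_lt with rfl | hlt
      · exact hBneg
      · exact (hin x ⟨hx.1, hlt⟩).2.1
    · have hB0 : B (γ s t) = 0 := by
        by_contra hB0
        exact hout ⟨hAneg, hBt.lt_of_ne hB0, hhpos, htδ⟩
      refine Or.inr (exists_crossing hA hLB (hsol s) ht hB0 (hB' _ hAt hB0 hhpos htδ) ?_)
      intro x hx
      rcases hx.2.eq_or_lt with rfl | hlt
      · exact hAneg
      · exact (hin x ⟨hx.1, hlt⟩).1
  have hopen : ∀ A B : ℝ × ℝ → ℝ, Continuous A → Continuous B → IsOpen {s : Icc (0 : ℝ) 1 |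
      ∃ t, 0 ≤ t ∧ 0 < A (γ s t) ∧ ∀ x ∈ Icc 0 t, B (γ s x) < 0} := by
    intro A B hA hB
    rw [isOpen_iff_mem_nhds]
    intro s hs
    obtain ⟨ε, hε, hcr⟩ := eventually_crossing hf hA hB (hsol s) hs
    have hcs : Continuous fun s : Icc (0 : ℝ) 1 => σ s := hσc.comp continuous_subtype_val
    filter_upwards [hcs.continuousAt.eventually (Metric.ball_mem_nhds (σ s) hε)] with r hr
    exact hcr _ (hsol r) (by rw [hγ0, hγ0]; exact hr)
  have hl : (0 : ℝ) ∈ Icc (0 : ℝ) 1 := by simp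
  have hr : (1 : ℝ) ∈ Icc (0 : ℝ) 1 := by simp
  obtain ⟨s, ⟨t₁, ht₁, hAt, hBn⟩, t₂, ht₂, hBt, hAn⟩ := nonempty_inter (hopen A B hA hB)
    (hopen B A hB hA) (eq_univ_of_forall hcross)
    ⟨⟨0, hl⟩, (hcross ⟨0, hl⟩).resolve_right fun ⟨t, ht, _, hAn⟩ => by
      have := hAn 0 ⟨le_rfl, ht⟩
      rw [hγ0] at this
      exact this.ne hσ0⟩
    ⟨⟨1, hr⟩, (hcross ⟨1, hr⟩).resolve_left fun ⟨t, ht, _, hBn⟩ => by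
      have := hBn 0 ⟨le_rfl, ht⟩
      rw [hγ0] at this
      exact this.ne hσ1⟩
  rcases le_total t₁ t₂ with hle | hle
  · exact (hAn t₁ ⟨ht₁, hle⟩).not_gt hAt
  · exact (hBn t₂ ⟨ht₂, hle⟩).not_gt hBt

theorem IsCenter.conj {f g : ℝ × ℝ → ℝ × ℝ} (h : IsCenter f 0) (L : (ℝ × ℝ) ≃L[ℝ] (ℝ × ℝ))
    (hg : ∀ w, g (L w) = L (f w)) : IsCenter g 0 := by
  obtain ⟨hq, U, hU, H⟩ := h
  refine ⟨by simpa [hq] using hg 0, L.symm ⁻¹' U, ?_, fun p hp hpq => ?_⟩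
  · exact L.symm.continuous.continuousAt.preimage_mem_nhds (by simpa using hU)
  obtain ⟨γ, T, h0, hsol, hT, hper, hnc, hr, hb⟩ := H (L.symm p) hp (by simpa using hpq)
  have hrange : range (fun t => L (γ t)) = L '' range γ := range_comp L γ
  refine ⟨fun t => L (γ t), T, by simp [h0], fun t => ?_, hT, fun t => by simp [hper],
    fun hc => hnc fun t => L.injective (hc t), ?_, ?_⟩
  · rw [hg]
    exact (L : (ℝ × ℝ) →L[ℝ] (ℝ × ℝ)).hasFDerivAt.comp_hasDerivAt t (hsol t)
  · rintro ⟨t, ht⟩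
    exact hr ⟨t, by simpa using ht⟩
  · have himg : (L '' range γ)ᶜ = L.toHomeomorph '' (range γ)ᶜ :=
      (image_compl_eq L.bijective).symm
    have h0' : (0 : ℝ × ℝ) = L.toHomeomorph 0 := by simp
    rw [hrange, himg, h0', ← L.toHomeomorph.image_connectedComponentIn hr]
    exact (L : (ℝ × ℝ) →L[ℝ] (ℝ × ℝ)).lipschitz.isBounded_image hb

/-- Rotation of the plane with cosine `c` and sine `s`. -/
noncomputable def planeRotation (c s : ℝ) (h : c ^ 2 + s ^ 2 = 1) : (ℝ × ℝ) ≃L[ℝ] (ℝ × ℝ) :=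
  LinearEquiv.toContinuousLinearEquiv
    { toFun := fun w => (c * w.1 + s * w.2, -s * w.1 + c * w.2)
      map_add' := fun x y => by ext <;> simp <;> ring
      map_smul' := fun k x => by ext <;> simp <;> ring
      invFun := fun w => (c * w.1 - s * w.2, s * w.1 + c * w.2)
      left_inv := fun w => by
        ext <;> simp only
        · linear_combination w.1 * h
        · linear_combination w.2 * h
      right_inv := fun w => by
        ext <;> simp only
        · linear_combination w.1 * h
        · linear_combination w.2 * h }

theorem planeRotation_apply (c s : ℝ) (h : c ^ 2 + s ^ 2 = 1) (w : ℝ × ℝ) :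
    planeRotation c s h w = (c * w.1 + s * w.2, -s * w.1 + c * w.2) := rfl

/-- The family `sysDagger` is invariant under rotations. -/
theorem IsCenter.rotate {a1 a2 a4 a5 a7 a8 : ℝ} (hc : IsCenter (sysDagger a1 a2 a4 a5 a7 a8) 0)
    (c s : ℝ) (h : c ^ 2 + s ^ 2 = 1) :
    IsCenter (sysDagger (c * a1 + s * a2) (-s * a1 + c * a2)
      (c ^ 2 * a4 + c * s * (a5 + a7) + s ^ 2 * a8)
      (-c * s * a4 + c ^ 2 * a5 - s ^ 2 * a7 + c * s * a8)
      (-c * s * a4 - s ^ 2 * a5 + c ^ 2 * a7 + c * s * a8)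
      (s ^ 2 * a4 - c * s * (a5 + a7) + c ^ 2 * a8)) 0 := by
  refine hc.conj (planeRotation c s h) fun w => ?_
  obtain ⟨u, v⟩ := w
  have hB : ∀ u v, (c ^ 2 * a4 + c * s * (a5 + a7) + s ^ 2 * a8) * (c * u + s * v) ^ 2
      + ((-c * s * a4 + c ^ 2 * a5 - s ^ 2 * a7 + c * s * a8)
        + (-c * s * a4 - s ^ 2 * a5 + c ^ 2 * a7 + c * s * a8)) * (c * u + s * v) * (-s * u + c * v)
      + (s ^ 2 * a4 - c * s * (a5 + a7) + c ^ 2 * a8) * (-s * u + c * v) ^ 2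
      = a4 * u ^ 2 + (a5 + a7) * u * v + a8 * v ^ 2 := by
    intro u v
    linear_combination (a4 * u ^ 2 + (a5 + a7) * u * v + a8 * v ^ 2) * (c ^ 2 + s ^ 2 + 1) * h
  have hl : (c * a1 + s * a2) * (c * u + s * v) + (-s * a1 + c * a2) * (-s * u + c * v)
      = a1 * u + a2 * v := by
    linear_combination (a1 * u + a2 * v) * h
  simp only [planeRotation_apply, sysDagger, Prod.mk.injEq]
  constructor
  · linear_combination (-s * u + c * v) * hl - (c * u + s * v) * hB u v
      + (-c * (a4 * u + a5 * v) - s * (a7 * u + a8 * v)) * h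
  · linear_combination -(c * u + s * v) * hl - (-s * u + c * v) * hB u v
      + (s * (a4 * u + a5 * v) - c * (a7 * u + a8 * v)) * h

theorem sysDagger_neg (a1 a2 a4 a5 a7 a8 : ℝ) :
    sysDagger (-a1) (-a2) (-a4) (-a5) (-a7) (-a8) =
      fun w => -sysDagger a1 a2 a4 a5 a7 a8 w := by
  funext w
  ext <;> simp only [sysDagger, Prod.neg_mk] <;> ring

theorem IsCenter.neg_sysDagger {a1 a2 a4 a5 a7 a8 : ℝ}
    (hc : IsCenter (sysDagger a1 a2 a4 a5 a7 a8) 0) :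
    IsCenter (sysDagger (-a1) (-a2) (-a4) (-a5) (-a7) (-a8)) 0 := by
  rw [sysDagger_neg]
  exact hc.neg

theorem contDiff_sysDagger (a1 a2 a4 a5 a7 a8 : ℝ) :
    ContDiff ℝ 1 (sysDagger a1 a2 a4 a5 a7 a8) := by
  unfold sysDagger
  fun_prop

/-- A remainder that is small relative to `S` does not change the sign of `k * S`. -/
theorem eventually_pos_of_abs_le {S r g : ℝ × ℝ → ℝ} {k : ℝ} (hk : k ≠ 0) (hg : Continuous g)
    (hg0 : g 0 = 0) (hr : ∀ w, |r w| ≤ S w * g w) (hS : ∀ w, w ≠ 0 → 0 < S w) :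
    ∀ᶠ w in 𝓝 (0 : ℝ × ℝ), w ≠ 0 → 0 < k * (k * S w + r w) := by
  have h1 : ∀ᶠ w in 𝓝 (0 : ℝ × ℝ), g w < |k| :=
    hg.continuousAt.eventually (gt_mem_nhds (by rw [hg0]; exact abs_pos.2 hk))
  filter_upwards [h1] with w hw h0
  have hSw := hS w h0
  have h2 : |k * r w| < |k| * (S w * |k|) := by
    rw [abs_mul]
    exact mul_lt_mul_of_pos_left ((hr w).trans_lt (by gcongr)) (abs_pos.2 hk)
  have h3 : |k| * (S w * |k|) = k ^ 2 * S w := by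
    rw [← sq_abs k]; ring
  have h4 := (abs_lt.1 h2).1
  nlinarith

theorem sum_sq_pos {w : ℝ × ℝ} (h : w ≠ 0) : 0 < w.1 ^ 2 + w.2 ^ 2 := by
  by_contra! hle
  refine h (Prod.ext ?_ ?_) <;> simp <;> nlinarith [sq_nonneg w.1, sq_nonneg w.2]

/-- A singular point whose linearization has positive determinant and nonzero trace is not a
center. -/
theorem not_isCenter_of_trace_ne_zero {a1 a2 a4 a5 a7 a8 : ℝ} (htr : a4 + a8 ≠ 0)
    (hdet : 0 < a4 * a8 - a5 * a7) : ¬ IsCenter (sysDagger a1 a2 a4 a5 a7 a8) 0 := by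
  set d := a4 * a8 - a5 * a7 with hd
  set α := d + a8 ^ 2 + a7 ^ 2 with hα
  set β := -(a8 * a5 + a4 * a7) with hβ
  set δ := d + a5 ^ 2 + a4 ^ 2 with hδ
  set l : ℝ × ℝ → ℝ := fun w => a1 * w.1 + a2 * w.2 with hl
  set b : ℝ × ℝ → ℝ := fun w => a4 * w.1 ^ 2 + (a5 + a7) * w.1 * w.2 + a8 * w.2 ^ 2 with hb
  set q0 : ℝ × ℝ → ℝ := fun w => -2 * β * l w - 2 * α * b w with hq0
  set q1 : ℝ × ℝ → ℝ := fun w => 2 * (α - δ) * l w - 4 * β * b w with hq1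
  set q2 : ℝ × ℝ → ℝ := fun w => 2 * β * l w - 2 * δ * b w with hq2
  refine not_isCenter_of_lyapunov_sign (κ := -2 * d * (a4 + a8))
    (V := fun w => α * w.1 ^ 2 + 2 * β * (w.1 * w.2) + δ * w.2 ^ 2)
    (V' := fun w => -2 * d * (a4 + a8) * (w.1 ^ 2 + w.2 ^ 2)
      + (w.1 ^ 2 * q0 w + w.1 * w.2 * q1 w + w.2 ^ 2 * q2 w))
    (by fun_prop) (by simp) ?_ ?_ ?_
  · intro γ hγ t
    have h1 := hγ.fst t
    have h2 := hγ.snd t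
    refine ((((h1.pow 2).const_mul α).add ((h1.mul h2).const_mul (2 * β))).add
      ((h2.pow 2).const_mul δ)).congr_deriv ?_
    simp only [sysDagger, hq0, hq1, hq2, hl, hb, hα, hβ, hδ, hd]
    ring
  · refine Eventually.of_forall fun w hw => ?_
    have h1 : α * w.1 ^ 2 + 2 * β * (w.1 * w.2) + δ * w.2 ^ 2
        = d * (w.1 ^ 2 + w.2 ^ 2) + (a8 * w.1 - a5 * w.2) ^ 2 + (a7 * w.1 - a4 * w.2) ^ 2 := by
      simp only [hα, hβ, hδ]; ring
    simp only [h1]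
    have := sum_sq_pos hw
    positivity
  · refine eventually_pos_of_abs_le (g := fun w => |q0 w| + |q1 w| + |q2 w|) ?_ (by fun_prop)
      (by simp [hq0, hq1, hq2, hl, hb]) (fun w => ?_) fun w hw => sum_sq_pos hw
    · have := hdet.ne'
      positivity
    · calc _ ≤ |w.1 ^ 2 * q0 w| + |w.1 * w.2 * q1 w| + |w.2 ^ 2 * q2 w| := abs_add_three _ _ _
        _ = w.1 ^ 2 * |q0 w| + |w.1 * w.2| * |q1 w| + w.2 ^ 2 * |q2 w| := by
          simp only [abs_mul, abs_pow, sq_abs]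
        _ ≤ (w.1 ^ 2 + w.2 ^ 2) * |q0 w| + (w.1 ^ 2 + w.2 ^ 2) * |q1 w|
            + (w.1 ^ 2 + w.2 ^ 2) * |q2 w| := by
          gcongr
          · nlinarith [sq_nonneg w.2]
          · rw [abs_le]; constructor <;> nlinarith [sq_nonneg (w.1 + w.2), sq_nonneg (w.1 - w.2)]
          · nlinarith [sq_nonneg w.1]
        _ = _ := by ring

/-- A weak focus whose first Lyapunov quantity does not vanish is not a center. -/
theorem not_isCenter_of_lyapunov_quantity {m n p q : ℝ} (hp : 0 < p) (hq : 0 < q)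
    (hK : (p - q) * m * n ≠ 0) : ¬ IsCenter (sysDagger m n 0 p (-q) 0) 0 := by
  have hden : 0 < 3 * p ^ 2 + 2 * p * q + 3 * q ^ 2 := by positivity
  obtain ⟨c, hc⟩ : ∃ c, c = p - q := ⟨_, rfl⟩
  obtain ⟨K, hKd⟩ : ∃ K, K = -2 * c * m * n * (p + q) / (3 * p ^ 2 + 2 * p * q + 3 * q ^ 2) :=
    ⟨_, rfl⟩
  have hKmul : K * (3 * p ^ 2 + 2 * p * q + 3 * q ^ 2) = -2 * c * m * n * (p + q) := by
    rw [hKd]; field_simp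
  have hK0 : K ≠ 0 := by
    rintro rfl
    rw [zero_mul] at hKmul
    have : (p - q) * m * n * (p + q) = 0 := by rw [← hc]; linarith
    rcases mul_eq_zero.1 this with h | h
    · exact hK h
    · linarith
  obtain ⟨b0, hb0⟩ : ∃ x, p * x = -2 * c * m / 3 := ⟨_, mul_div_cancel₀ _ hp.ne'⟩
  obtain ⟨b3, hb3⟩ : ∃ x, q * x = 2 * c * n / 3 := ⟨_, mul_div_cancel₀ _ hq.ne'⟩
  obtain ⟨e1, he1⟩ : ∃ x, q * x = K := ⟨_, mul_div_cancel₀ _ hq.ne'⟩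
  obtain ⟨e3, he3⟩ : ∃ x, p * x = -K := ⟨_, mul_div_cancel₀ _ hp.ne'⟩
  obtain ⟨e0, he0⟩ : ∃ x, p * x = (3 * b0 * m - 2 * c * q) / 4 := ⟨_, mul_div_cancel₀ _ hp.ne'⟩
  obtain ⟨e4, he4⟩ : ∃ x, q * x = (3 * b3 * n + 2 * c * p) / 4 := ⟨_, mul_div_cancel₀ _ hq.ne'⟩
  have hmid : -3 * p * e1 + 3 * q * e3 + 3 * b0 * n - 3 * b3 * m = 2 * K := by
    have hpq : p * q ≠ 0 := by positivity
    apply mul_left_cancel₀ hpq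
    linear_combination (-3 * p ^ 2) * he1 + 3 * q ^ 2 * he3 + 3 * q * n * hb0 - 3 * p * m * hb3
      - hKmul
  set l : ℝ × ℝ → ℝ := fun w => m * w.1 + n * w.2 with hl
  set q0 : ℝ × ℝ → ℝ := fun w => -e1 * l w with hq0
  set q1 : ℝ × ℝ → ℝ := fun w => -3 * c * b0 * w.1 + 4 * e0 * l w
    - 4 * c * (e0 * w.1 ^ 2 + e1 * w.1 * w.2) with hq1
  set q2 : ℝ × ℝ → ℝ := fun w => (3 * e1 - 3 * e3) * l w with hq2
  set q3 : ℝ × ℝ → ℝ := fun w => -3 * c * b3 * w.2 - 4 * e4 * l w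
    - 4 * c * (e3 * w.1 * w.2 + e4 * w.2 ^ 2) with hq3
  set q4 : ℝ × ℝ → ℝ := fun w => e3 * l w with hq4
  refine not_isCenter_of_lyapunov_sign (κ := K)
    (V := fun w => q * w.1 ^ 2 + p * w.2 ^ 2 + b0 * w.1 ^ 3 + b3 * w.2 ^ 3 + e0 * w.1 ^ 4
      + e1 * (w.1 ^ 3 * w.2) + e3 * (w.1 * w.2 ^ 3) + e4 * w.2 ^ 4)
    (V' := fun w => K * (w.1 ^ 2 + w.2 ^ 2) ^ 2
      + (w.1 ^ 4 * q0 w + w.1 ^ 3 * w.2 * q1 w + w.1 ^ 2 * w.2 ^ 2 * q2 w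
        + w.1 * w.2 ^ 3 * q3 w + w.2 ^ 4 * q4 w))
    (by fun_prop) (by simp) ?_ ?_ ?_
  · intro γ hγ t
    have h1 := hγ.fst t
    have h2 := hγ.snd t
    refine (((((((((h1.pow 2).const_mul q).add ((h2.pow 2).const_mul p)).add
      ((h1.pow 3).const_mul b0)).add ((h2.pow 3).const_mul b3)).add
      ((h1.pow 4).const_mul e0)).add (((h1.pow 3).mul h2).const_mul e1)).add
      ((h1.mul (h2.pow 3)).const_mul e3)).add ((h2.pow 4).const_mul e4)).congr_deriv ?_
    simp only [sysDagger, hq0, hq1, hq2, hq3, hq4, hl, Nat.cast_ofNat, Nat.add_one_sub_one,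
      Pi.pow_apply]
    generalize (γ t).1 = u
    generalize (γ t).2 = v
    subst hc
    linear_combination -3 * u ^ 2 * v * hb0 + 3 * u * v ^ 2 * hb3 + u ^ 4 * he1
      - 4 * u ^ 3 * v * he0 + u ^ 2 * v ^ 2 * hmid + 4 * u * v ^ 3 * he4 - v ^ 4 * he3
  · have hev : ∀ᶠ w in 𝓝 (0 : ℝ × ℝ), 0 < q + b0 * w.1 + e0 * w.1 ^ 2 + e1 * (w.1 * w.2) ∧
        0 < p + b3 * w.2 + e3 * (w.1 * w.2) + e4 * w.2 ^ 2 := by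
      have c1 : Continuous fun w : ℝ × ℝ => q + b0 * w.1 + e0 * w.1 ^ 2 + e1 * (w.1 * w.2) := by
        fun_prop
      have c2 : Continuous fun w : ℝ × ℝ => p + b3 * w.2 + e3 * (w.1 * w.2) + e4 * w.2 ^ 2 := by
        fun_prop
      exact (c1.continuousAt.eventually (lt_mem_nhds (by simpa using hq))).and
        (c2.continuousAt.eventually (lt_mem_nhds (by simpa using hp)))
    filter_upwards [hev] with w hw h0
    have heq : q * w.1 ^ 2 + p * w.2 ^ 2 + b0 * w.1 ^ 3 + b3 * w.2 ^ 3 + e0 * w.1 ^ 4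
      + e1 * (w.1 ^ 3 * w.2) + e3 * (w.1 * w.2 ^ 3) + e4 * w.2 ^ 4
      = w.1 ^ 2 * (q + b0 * w.1 + e0 * w.1 ^ 2 + e1 * (w.1 * w.2))
        + w.2 ^ 2 * (p + b3 * w.2 + e3 * (w.1 * w.2) + e4 * w.2 ^ 2) := by ring
    rw [heq]
    by_cases h1 : w.1 = 0
    · have h2 : w.2 ≠ 0 := fun h2 => h0 (Prod.ext h1 h2)
      have := mul_pos (pow_pos (abs_pos.2 h2) 2) hw.2
      rw [sq_abs] at this
      simpa [h1] using this
    · exact add_pos_of_pos_of_nonneg (mul_pos (by positivity) hw.1)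
        (mul_nonneg (sq_nonneg _) hw.2.le)
  · refine eventually_pos_of_abs_le (S := fun w => (w.1 ^ 2 + w.2 ^ 2) ^ 2)
      (g := fun w => |q0 w| + |q1 w| + |q2 w| + |q3 w| + |q4 w|) hK0 (by fun_prop)
      (by simp [hq0, hq1, hq2, hq3, hq4, hl]) (fun w => ?_)
      fun w hw => pow_pos (sum_sq_pos hw) 2
    have hu := sq_nonneg w.1
    have hv := sq_nonneg w.2
    have huv : |w.1 * w.2| ≤ w.1 ^ 2 + w.2 ^ 2 := by
      rw [abs_le]; constructor <;> nlinarith [sq_nonneg (w.1 + w.2), sq_nonneg (w.1 - w.2)]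
    have m0 : |w.1 ^ 4| ≤ (w.1 ^ 2 + w.2 ^ 2) ^ 2 := by
      rw [abs_of_nonneg (by positivity)]; nlinarith
    have m4 : |w.2 ^ 4| ≤ (w.1 ^ 2 + w.2 ^ 2) ^ 2 := by
      rw [abs_of_nonneg (by positivity)]; nlinarith
    have m2 : |w.1 ^ 2 * w.2 ^ 2| ≤ (w.1 ^ 2 + w.2 ^ 2) ^ 2 := by
      rw [abs_of_nonneg (by positivity)]; nlinarith
    have m1 : |w.1 ^ 3 * w.2| ≤ (w.1 ^ 2 + w.2 ^ 2) ^ 2 := by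
      rw [show w.1 ^ 3 * w.2 = w.1 ^ 2 * (w.1 * w.2) by ring, abs_mul, abs_of_nonneg hu, sq (_ + _)]
      exact mul_le_mul (by linarith) huv (abs_nonneg _) (by positivity)
    have m3 : |w.1 * w.2 ^ 3| ≤ (w.1 ^ 2 + w.2 ^ 2) ^ 2 := by
      rw [show w.1 * w.2 ^ 3 = w.2 ^ 2 * (w.1 * w.2) by ring, abs_mul, abs_of_nonneg hv, sq (_ + _)]
      exact mul_le_mul (by linarith) huv (abs_nonneg _) (by positivity)
    calc _ ≤ |w.1 ^ 4 * q0 w| + |w.1 ^ 3 * w.2 * q1 w| + |w.1 ^ 2 * w.2 ^ 2 * q2 w|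
          + |w.1 * w.2 ^ 3 * q3 w| + |w.2 ^ 4 * q4 w| :=
          (abs_add_le _ _).trans (add_le_add_left ((abs_add_le _ _).trans
            (add_le_add_left (abs_add_three _ _ _) _)) _)
      _ = |w.1 ^ 4| * |q0 w| + |w.1 ^ 3 * w.2| * |q1 w| + |w.1 ^ 2 * w.2 ^ 2| * |q2 w|
          + |w.1 * w.2 ^ 3| * |q3 w| + |w.2 ^ 4| * |q4 w| := by
          simp only [abs_mul]
      _ ≤ (w.1 ^ 2 + w.2 ^ 2) ^ 2 * |q0 w| + (w.1 ^ 2 + w.2 ^ 2) ^ 2 * |q1 w|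
          + (w.1 ^ 2 + w.2 ^ 2) ^ 2 * |q2 w| + (w.1 ^ 2 + w.2 ^ 2) ^ 2 * |q3 w|
          + (w.1 ^ 2 + w.2 ^ 2) ^ 2 * |q4 w| := by
          gcongr
      _ = _ := by ring

/-- If the linear part of `sysDagger` has real eigenvalues `-lam < 0 ≤ mu` with independent
eigenfunctionals, then the origin is not a center. -/
theorem not_isCenter_of_eigenfunctionals {a1 a2 a4 a5 a7 a8 p1 p2 q1 q2 lam mu : ℝ}
    (hD : p1 * q2 - p2 * q1 ≠ 0) (hlam : 0 < lam) (hmu : 0 ≤ mu)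
    (hp1 : p1 * a4 + p2 * a7 = lam * p1) (hp2 : p1 * a5 + p2 * a8 = lam * p2)
    (hq1 : q1 * a4 + q2 * a7 = -mu * q1) (hq2 : q1 * a5 + q2 * a8 = -mu * q2) :
    ¬ IsCenter (sysDagger a1 a2 a4 a5 a7 a8) 0 := by
  set D := p1 * q2 - p2 * q1 with hDd
  set l : ℝ × ℝ → ℝ := fun w => a1 * w.1 + a2 * w.2 with hl
  set b : ℝ × ℝ → ℝ := fun w => a4 * w.1 ^ 2 + (a5 + a7) * w.1 * w.2 + a8 * w.2 ^ 2 with hb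
  set x : ℝ × ℝ → ℝ := fun w => p1 * w.1 + p2 * w.2 with hx
  set y : ℝ × ℝ → ℝ := fun w => q1 * w.1 + q2 * w.2 with hy
  set g1 : ℝ × ℝ → ℝ := fun w => -p2 * l w - p1 * b w with hg1
  set g2 : ℝ × ℝ → ℝ := fun w => p1 * l w - p2 * b w with hg2
  set k1 : ℝ × ℝ → ℝ := fun w => -q2 * l w - q1 * b w with hk1
  set k2 : ℝ × ℝ → ℝ := fun w => q1 * l w - q2 * b w with hk2
  set x' : ℝ × ℝ → ℝ := fun w => -lam * x w + (w.1 * g1 w + w.2 * g2 w) with hx'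
  set y' : ℝ × ℝ → ℝ := fun w => mu * y w + (w.1 * k1 w + w.2 * k2 w) with hy'
  set G : ℝ × ℝ → ℝ := fun w => |g1 w| + |g2 w| + |k1 w| + |k2 w| with hG
  have hGc : Continuous G := by fun_prop
  have hxc : Continuous x := by fun_prop
  have hyc : Continuous y := by fun_prop
  have hLx : HasLieDeriv (sysDagger a1 a2 a4 a5 a7 a8) x x' := fun γ hγ t => by
    refine (((hγ.fst t).const_mul p1).add ((hγ.snd t).const_mul p2)).congr_deriv ?_
    simp only [sysDagger, hx', hx, hg1, hg2, hl, hb]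
    linear_combination -(γ t).1 * hp1 - (γ t).2 * hp2
  have hLy : HasLieDeriv (sysDagger a1 a2 a4 a5 a7 a8) y y' := fun γ hγ t => by
    refine (((hγ.fst t).const_mul q1).add ((hγ.snd t).const_mul q2)).congr_deriv ?_
    simp only [sysDagger, hy', hy, hk1, hk2, hl, hb]
    linear_combination -(γ t).1 * hq1 - (γ t).2 * hq2
  obtain ⟨K, hKd⟩ : ∃ K, K = (|p1| + |p2| + |q1| + |q2|) / |D| + 1 := ⟨_, rfl⟩
  have hK : 0 < K := by rw [hKd]; positivity
  have hDp : 0 < |D| := abs_pos.2 hD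
  have hKD : |p1| + |p2| + |q1| + |q2| ≤ K * |D| := by
    rw [hKd, add_mul, div_mul_cancel₀ _ hDp.ne']; linarith
  have hnorm : ∀ w, |y w| ≤ x w → ‖w‖ ≤ K * x w := by
    intro w hw
    have hx0 : 0 ≤ x w := (abs_nonneg _).trans hw
    have h1 : D * w.1 = q2 * x w - p2 * y w := by simp only [hDd, hx, hy]; ring
    have h2 : D * w.2 = p1 * y w - q1 * x w := by simp only [hDd, hx, hy]; ring
    have hbd : ∀ c d e : ℝ, |c| + |d| ≤ |p1| + |p2| + |q1| + |q2| →
        D * e = c * x w - d * y w → |e| ≤ K * x w := by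
      intro c d e hcd he
      have h3 : |D| * |e| ≤ (|c| + |d|) * x w := by
        rw [← abs_mul, he]
        refine (abs_sub _ _).trans ?_
        rw [abs_mul, abs_mul, abs_of_nonneg hx0, add_mul]
        gcongr
      refine le_of_mul_le_mul_left ?_ hDp
      calc |D| * |e| ≤ (|c| + |d|) * x w := h3
        _ ≤ K * |D| * x w := by gcongr; exact hcd.trans hKD
        _ = |D| * (K * x w) := by ring
    refine max_le (hbd q2 p2 _ ?_ h1) (hbd (-q1) (-p1) _ ?_ (by linarith))
    · linarith [abs_nonneg p1, abs_nonneg q1]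
    · rw [abs_neg, abs_neg]; linarith [abs_nonneg p2, abs_nonneg q2]
  obtain ⟨r, hr, hball⟩ := Metric.eventually_nhds_iff.1
    ((hGc.tendsto 0).eventually (gt_mem_nhds
      (show G 0 < lam / (4 * K) by simp only [hG, hg1, hg2, hk1, hk2, hl, hb]; simp; positivity)))
  have hsmall : ∀ w, |y w| ≤ x w → 0 < x w → x w < r / K →
      |w.1 * g1 w + w.2 * g2 w| + |w.1 * k1 w + w.2 * k2 w| < lam / 2 * x w := by
    intro w hw h0 hδ
    have hn := hnorm w hw
    have hlt : G w < lam / (4 * K) := hball (by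
      rw [dist_zero_right]
      exact hn.trans_lt (by rwa [lt_div_iff₀' hK] at hδ))
    have h1 : |w.1| ≤ K * x w := (norm_fst_le w).trans hn
    have h2 : |w.2| ≤ K * x w := (norm_snd_le w).trans hn
    calc _ ≤ (|w.1 * g1 w| + |w.2 * g2 w|) + (|w.1 * k1 w| + |w.2 * k2 w|) :=
          add_le_add (abs_add_le _ _) (abs_add_le _ _)
      _ = (|w.1| * |g1 w| + |w.2| * |g2 w|) + (|w.1| * |k1 w| + |w.2| * |k2 w|) := by
          simp only [abs_mul]
      _ ≤ (K * x w * |g1 w| + K * x w * |g2 w|) + (K * x w * |k1 w| + K * x w * |k2 w|) := by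
          gcongr
      _ = K * x w * G w := by simp only [hG]; ring
      _ ≤ K * x w * (lam / (4 * K)) := by gcongr
      _ = lam / 4 * x w := by field_simp
      _ < lam / 2 * x w := by gcongr; norm_num
  refine not_isCenter_of_sector (contDiff_sysDagger _ _ _ _ _ _) (A := fun w => y w - x w)
    (A' := fun w => y' w - x' w) (B := fun w => -y w - x w) (B' := fun w => -y' w - x' w)
    (h := x) (h' := x') (δ := r / K) (hyc.sub hxc) (hyc.neg.sub hxc) hxc
    (fun γ hγ t => (hLy γ hγ t).sub (hLx γ hγ t))
    (fun γ hγ t => (hLy γ hγ t).neg.sub (hLx γ hγ t)) hLx (by simp [hx]) ?_ ?_ ?_ ?_ ?_ ?_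
  · intro w h1 h2; linarith
  · intro w h1 h2 h3
    have h4 := hnorm w (abs_le.2 ⟨by linarith, by linarith⟩)
    rw [h3, mul_zero] at h4
    exact norm_le_zero_iff.1 h4
  · intro w h1 h2 h3 h4
    have h5 := hsmall w (abs_le.2 ⟨by linarith, by linarith⟩) h3 h4
    have h6 := neg_abs_le (w.1 * k1 w + w.2 * k2 w)
    have h7 := le_abs_self (w.1 * g1 w + w.2 * g2 w)
    have h8 : 0 ≤ mu * y w := mul_nonneg hmu (by linarith)
    have h9 := mul_pos hlam h3
    simp only [hy', hx']
    linarith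
  · intro w h1 h2 h3 h4
    have h5 := hsmall w (abs_le.2 ⟨by linarith, by linarith⟩) h3 h4
    have h6 := le_abs_self (w.1 * k1 w + w.2 * k2 w)
    have h7 := le_abs_self (w.1 * g1 w + w.2 * g2 w)
    have h8 : 0 ≤ mu * (-y w) := mul_nonneg hmu (by linarith)
    have h9 := mul_pos hlam h3
    simp only [hy', hx']
    linarith
  · intro w h1 h2 h3 h4
    have h5 := hsmall w (abs_le.2 ⟨by linarith, by linarith⟩) h3 h4
    have h6 := abs_nonneg (w.1 * k1 w + w.2 * k2 w)
    have h7 := le_abs_self (w.1 * g1 w + w.2 * g2 w)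
    have h9 := mul_pos hlam h3
    simp only [hx']
    linarith
  · intro U hU
    obtain ⟨R, hR, hRU⟩ := Metric.mem_nhds_iff.1 hU
    obtain ⟨ε, hε, hε'⟩ := exists_between (show 0 < min R r / K by positivity)
    rw [lt_div_iff₀' hK, lt_min_iff] at hε'
    have hσx : ∀ s, x ((q2 * ε - p2 * (ε * (1 - 2 * s))) / D,
        (p1 * (ε * (1 - 2 * s)) - q1 * ε) / D) = ε := fun s => by
      simp only [hx]; field_simp; simp only [hDd]; ring
    have hσy : ∀ s, y ((q2 * ε - p2 * (ε * (1 - 2 * s))) / D,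
        (p1 * (ε * (1 - 2 * s)) - q1 * ε) / D) = ε * (1 - 2 * s) := fun s => by
      simp only [hy]; field_simp; simp only [hDd]; ring
    refine ⟨fun s => ((q2 * ε - p2 * (ε * (1 - 2 * s))) / D,
        (p1 * (ε * (1 - 2 * s)) - q1 * ε) / D), by fun_prop, fun s hs => ?_, ?_, ?_⟩
    · have h1 : 0 ≤ ε * s := mul_nonneg hε.le hs.1
      have h2 : ε * s ≤ ε := mul_le_of_le_one_right hε.le hs.2
      simp only [hσx, hσy]
      refine ⟨hRU ?_, by linarith, by linarith, hε, by rw [lt_div_iff₀' hK]; exact hε'.2⟩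
      rw [mem_ball_zero_iff]
      refine (hnorm _ ?_).trans_lt ?_
      · rw [hσx, hσy, abs_le]; constructor <;> linarith
      · rw [hσx]; exact hε'.1
    · simp only [hσx, hσy]; ring
    · simp only [hσx, hσy]; ring

/-- A cusp is not a center. -/
theorem not_isCenter_of_cusp {p q a2 : ℝ} (hp : 0 < p) (hq : 0 < q) :
    ¬ IsCenter (sysDagger (-q) a2 0 (-p) 0 0) 0 := by
  obtain ⟨C, hC⟩ : ∃ C, C = 4 * q / (3 * p) := ⟨_, rfl⟩
  have hC0 : 0 < C := by rw [hC]; positivity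
  have hCp : 3 * C * p = 4 * q := by rw [hC]; field_simp
  have hpq : ∀ᶠ δ in 𝓝 (0 : ℝ), q * δ + |a2| * (√(C * δ) * δ) < p ∧
      2 * |a2| * √(C * δ) + 2 * p * C * δ ^ 2 + 3 * C * (q * δ + |a2| * (√(C * δ) * δ))
        < 2 * q := by
    have c1 : Continuous fun δ : ℝ => q * δ + |a2| * (√(C * δ) * δ) := by fun_prop
    have c2 : Continuous fun δ : ℝ => 2 * |a2| * √(C * δ) + 2 * p * C * δ ^ 2
      + 3 * C * (q * δ + |a2| * (√(C * δ) * δ)) := by fun_prop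
    exact ((c1.tendsto 0).eventually (gt_mem_nhds (by simpa using hp))).and
      ((c2.tendsto 0).eventually (gt_mem_nhds (by simpa using hq)))
  obtain ⟨δ, ⟨hδ1, hδ2⟩, hδ⟩ :=
    ((hpq.filter_mono nhdsWithin_le_nhds).and (self_mem_nhdsWithin (s := Ioi 0))).exists
  have hv : ∀ w : ℝ × ℝ, w.2 ^ 2 - C * w.1 ^ 3 ≤ 0 → 0 < w.1 → w.1 < δ →
      |a2 * w.2| ≤ |a2| * √(C * δ) * w.1 := by
    intro w h1 h2 h3
    rw [abs_mul, mul_assoc]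
    gcongr
    refine abs_le_of_sq_le_sq ?_ (by positivity)
    rw [mul_pow, Real.sq_sqrt (by positivity)]
    calc w.2 ^ 2 ≤ C * w.1 * w.1 ^ 2 := by linarith
      _ ≤ C * δ * w.1 ^ 2 := by gcongr
  refine not_isCenter_of_sector (contDiff_sysDagger _ _ _ _ _ _) (A := fun w => w.2)
    (A' := fun w => q * w.1 ^ 2 - a2 * w.1 * w.2 + p * w.1 * w.2 ^ 2)
    (B := fun w => w.2 ^ 2 - C * w.1 ^ 3)
    (B' := fun w => w.2 * w.1 * (-2 * q * w.1 - 2 * (a2 * w.2) + 2 * p * w.2 ^ 2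
      - 3 * C * w.1 * (-q * w.1 + a2 * w.2 + p * w.1 ^ 2)))
    (h := fun w => w.1) (h' := fun w => w.2 * (p - q * w.1 + a2 * w.2 + p * w.1 ^ 2))
    (δ := δ) (by fun_prop) (by fun_prop) (by fun_prop) ?_ ?_ ?_ rfl ?_ ?_ ?_ ?_ ?_ ?_
  · intro γ hγ t
    refine (hγ.snd t).congr_deriv ?_
    simp only [sysDagger]; ring
  · intro γ hγ t
    refine (((hγ.snd t).pow 2).sub (((hγ.fst t).pow 3).const_mul C)).congr_deriv ?_
    simp only [sysDagger, Nat.cast_ofNat, Nat.add_one_sub_one]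
    linear_combination -(γ t).1 ^ 2 * (γ t).2 * hCp
  · intro γ hγ t
    refine (hγ.fst t).congr_deriv ?_
    simp only [sysDagger]; ring
  · intro w h1 h2
    by_contra! h3
    have := pow_pos h3 3
    rw [h1] at h2
    nlinarith
  · intro w h1 h2 h3
    rw [h3] at h2
    have h4 : w.2 = 0 := by nlinarith [sq_nonneg w.2]
    exact Prod.ext h3 h4
  · intro w h1 h2 h3 h4
    simp only [h1]
    nlinarith [pow_pos h3 2]
  · intro w h1 h2 h3 h4
    have hb := abs_le.1 (hv w h2.le h3 h4)
    have hneg : w.2 < 0 := by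
      refine h1.lt_of_ne fun h0 => ?_
      rw [h0] at h2
      nlinarith [pow_pos h3 3]
    refine mul_pos_of_neg_of_neg (mul_neg_of_neg_of_pos hneg h3) ?_
    have e1 : w.2 ^ 2 = C * w.1 ^ 3 := by linarith
    have e2 : w.1 ^ 2 ≤ δ ^ 2 := by gcongr
    have e3 : 2 * p * w.2 ^ 2 ≤ 2 * p * C * δ ^ 2 * w.1 := by
      rw [e1]
      calc 2 * p * (C * w.1 ^ 3) = 2 * p * C * w.1 ^ 2 * w.1 := by ring
        _ ≤ _ := by gcongr
    have e4 : -(3 * C * w.1 * (-q * w.1 + a2 * w.2 + p * w.1 ^ 2))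
        ≤ 3 * C * w.1 * (q * δ + |a2| * (√(C * δ) * δ)) := by
      rw [← mul_neg]
      gcongr
      have e5 : q * w.1 ≤ q * δ := by gcongr
      have e6 : |a2| * √(C * δ) * w.1 ≤ |a2| * √(C * δ) * δ := by gcongr
      have e7 : 0 ≤ p * w.1 ^ 2 := by positivity
      linarith [hb.1]
    have e8 := mul_lt_mul_of_pos_right hδ2 h3
    nlinarith [hb.1]
  · intro w h1 h2 h3 h4
    have hb := abs_le.1 (hv w h2.le h3 h4)
    refine mul_neg_of_neg_of_pos h1 ?_
    have e5 : q * w.1 ≤ q * δ := by gcongr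
    have e6 : |a2| * √(C * δ) * w.1 ≤ |a2| * √(C * δ) * δ := by gcongr
    have e7 : 0 ≤ p * w.1 ^ 2 := by positivity
    linarith [hb.1]
  · intro U hU
    obtain ⟨R, hR, hRU⟩ := Metric.mem_nhds_iff.1 hU
    have hε : ∀ᶠ ε in 𝓝 (0 : ℝ), ε < δ ∧ ε < R ∧ √(C * ε ^ 3) < R := by
      have c1 : Continuous fun ε : ℝ => √(C * ε ^ 3) := by fun_prop
      exact (gt_mem_nhds hδ).and ((gt_mem_nhds hR).and
        ((c1.tendsto 0).eventually (gt_mem_nhds (by simpa using hR))))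
    obtain ⟨ε, ⟨h1, h2, h3⟩, h4⟩ :=
      ((hε.filter_mono nhdsWithin_le_nhds).and (self_mem_nhdsWithin (s := Ioi 0))).exists
    have hsq : √(C * ε ^ 3) ^ 2 = C * ε ^ 3 := Real.sq_sqrt (by positivity)
    refine ⟨fun s => (ε, -s * √(C * ε ^ 3)), by fun_prop, fun s hs => ⟨hRU ?_, ?_, ?_, h4, h1⟩,
      by simp, ?_⟩
    · rw [mem_ball_zero_iff]
      refine max_lt ?_ ?_
      · rwa [Real.norm_of_nonneg h4.le]
      · rw [Real.norm_eq_abs, abs_mul, abs_neg, abs_of_nonneg hs.1,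
          abs_of_nonneg (Real.sqrt_nonneg _)]
        exact (mul_le_of_le_one_left (Real.sqrt_nonneg _) hs.2).trans_lt h3
    · exact mul_nonpos_of_nonpos_of_nonneg (neg_nonpos.2 hs.1) (Real.sqrt_nonneg _)
    · have : (-s * √(C * ε ^ 3)) ^ 2 = s ^ 2 * (C * ε ^ 3) := by rw [mul_pow, hsq, neg_sq]
      simp only [this]
      have h5 : s ^ 2 ≤ 1 := pow_le_one₀ hs.1 hs.2
      have h6 : 0 < C * ε ^ 3 := by positivity
      nlinarith
    · simp only [neg_one_mul, neg_sq, hsq, sub_self]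

theorem not_isCenter_of_line {f : ℝ × ℝ → ℝ × ℝ} (hf : ContDiff ℝ 1 f) {d : ℝ × ℝ} (hd : d ≠ 0)
    (h : ∀ t : ℝ, f (t • d) = 0) : ¬ IsCenter f 0 := fun hc => by
  have hcont : Continuous fun t : ℝ => t • d := by fun_prop
  have h1 := (hcont.tendsto' 0 0 (zero_smul _ _)).eventually (hc.eventually_ne_zero hf)
  obtain ⟨t, ht, ht0⟩ :=
    ((h1.filter_mono nhdsWithin_le_nhds).and (self_mem_nhdsWithin (s := Ioi 0))).exists
  exact ht (smul_ne_zero (ne_of_gt ht0) hd) (h t)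

theorem not_isCenter_of_nilpotent {a1 a2 a5 : ℝ} : ¬ IsCenter (sysDagger a1 a2 0 a5 0 0) 0 := by
  rcases eq_or_ne a1 0 with rfl | h1
  · refine not_isCenter_of_line (contDiff_sysDagger _ _ _ _ _ _) (d := (1, 0)) (by simp) fun t => ?_
    simp [sysDagger]
  rcases eq_or_ne a5 0 with rfl | h5
  · refine not_isCenter_of_line (contDiff_sysDagger _ _ _ _ _ _) (d := (a2, -a1)) (by simp [h1])
      fun t => ?_
    ext <;> simp [sysDagger] <;> ring
  have key : ∀ {b1 b2 b5 : ℝ}, b1 ≠ 0 → b5 < 0 → ¬ IsCenter (sysDagger b1 b2 0 b5 0 0) 0 := by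
    intro b1 b2 b5 hb1 hb5 hc
    rcases hb1.lt_or_gt with hb1 | hb1
    · rw [← neg_neg b1, ← neg_neg b5] at hc
      exact not_isCenter_of_cusp (neg_pos.2 hb5) (neg_pos.2 hb1) hc
    · have := hc.rotate (-1) 0 (by norm_num)
      refine not_isCenter_of_cusp (p := -b5) (q := b1) (a2 := -b2) (neg_pos.2 hb5) hb1 ?_
      simpa using this
  intro hc
  rcases h5.lt_or_gt with h5 | h5
  · exact key h1 h5 hc
  · have := hc.neg_sysDagger
    rw [neg_zero] at this
    exact key (neg_ne_zero.2 h1) (neg_neg_iff_pos.2 h5) this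

theorem not_isCenter_of_triangular {a1 a2 a4 a5 a8 : ℝ} (h : a4 * a8 ≤ 0) :
    ¬ IsCenter (sysDagger a1 a2 a4 a5 0 a8) 0 := by
  have key : ∀ {b1 b2 b4 b5 b8 : ℝ}, (0 < b4 ∧ b8 ≤ 0) ∨ (b4 ≤ 0 ∧ 0 < b8) →
      ¬ IsCenter (sysDagger b1 b2 b4 b5 0 b8) 0 := by
    rintro b1 b2 b4 b5 b8 (⟨h4, h8⟩ | ⟨h4, h8⟩)
    · have hne : b4 - b8 ≠ 0 := by linarith
      refine not_isCenter_of_eigenfunctionals (p1 := 1) (p2 := b5 / (b4 - b8)) (q1 := 0) (q2 := 1)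
        (lam := b4) (mu := -b8) (by simp) h4 (by linarith) (by ring) ?_ (by ring) (by ring)
      field_simp; ring
    · have hne : b4 - b8 ≠ 0 := by linarith
      refine not_isCenter_of_eigenfunctionals (p1 := 0) (p2 := 1) (q1 := 1) (q2 := b5 / (b4 - b8))
        (lam := b8) (mu := -b4) (by simp) h8 (by linarith) (by ring) (by ring) (by ring) ?_
      field_simp; ring
  intro hc
  have hc' := hc.neg_sysDagger
  rw [neg_zero] at hc'
  rcases lt_trichotomy a4 0 with h4 | rfl | h4
  · exact key (Or.inl ⟨by linarith, by nlinarith⟩) hc'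
  · rcases lt_trichotomy a8 0 with h8 | rfl | h8
    · exact key (Or.inr ⟨by linarith, by linarith⟩) hc'
    · exact not_isCenter_of_nilpotent hc
    · exact key (Or.inr ⟨le_rfl, h8⟩) hc
  · exact key (Or.inl ⟨h4, by nlinarith⟩) hc

/-- An indefinite or degenerate binary quadratic form vanishes somewhere on the unit circle. -/
theorem exists_isotropic {A B C : ℝ} (h : 0 ≤ B ^ 2 - 4 * A * C) :
    ∃ c s : ℝ, c ^ 2 + s ^ 2 = 1 ∧ A * c ^ 2 + B * (c * s) + C * s ^ 2 = 0 := by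
  rcases eq_or_ne A 0 with rfl | hA
  · exact ⟨1, 0, by norm_num, by norm_num⟩
  obtain ⟨x, hx⟩ : ∃ x, A * (x * x) + B * x + C = 0 :=
    exists_quadratic_eq_zero hA ⟨√(discrim A B C), (Real.mul_self_sqrt h).symm⟩
  have h1 : 0 < x ^ 2 + 1 := by positivity
  have h2 : √(x ^ 2 + 1) ^ 2 = x ^ 2 + 1 := Real.sq_sqrt h1.le
  refine ⟨x / √(x ^ 2 + 1), 1 / √(x ^ 2 + 1), ?_, ?_⟩
  · rw [div_pow, div_pow, h2]; field_simp
  · rw [div_mul_div_comm, div_pow, div_pow, ← sq, h2]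
    field_simp
    linear_combination hx

theorem IsCenter.det_pos {a1 a2 a4 a5 a7 a8 : ℝ} (hc : IsCenter (sysDagger a1 a2 a4 a5 a7 a8) 0) :
    0 < a4 * a8 - a5 * a7 := by
  by_contra! hdet
  obtain ⟨c, s, h, hcs⟩ := exists_isotropic (A := a7) (B := a8 - a4) (C := -a5)
    (by nlinarith [sq_nonneg (a4 + a8)])
  have hr := hc.rotate c s h
  have h7 : -c * s * a4 - s ^ 2 * a5 + c ^ 2 * a7 + c * s * a8 = 0 := by linear_combination hcs
  rw [h7] at hr
  refine not_isCenter_of_triangular ?_ hr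
  refine le_of_eq_of_le ?_ hdet
  linear_combination (a4 * a8 - a5 * a7) * (c ^ 2 + s ^ 2 + 1) * h
    + (-c * s * a4 + c ^ 2 * a5 - s ^ 2 * a7 + c * s * a8) * h7

theorem IsCenter.trace_eq_zero {a1 a2 a4 a5 a7 a8 : ℝ}
    (hc : IsCenter (sysDagger a1 a2 a4 a5 a7 a8) 0) : a4 + a8 = 0 := by
  by_contra h
  exact not_isCenter_of_trace_ne_zero h hc.det_pos hc

theorem IsCenter.lyapunov_quantity_eq_zero {a1 a2 a4 a5 a7 a8 : ℝ}
    (hc : IsCenter (sysDagger a1 a2 a4 a5 a7 a8) 0) :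
    a4 * (a1 ^ 2 - a2 ^ 2) + a1 * a2 * (a5 + a7) = 0 := by
  obtain rfl : a8 = -a4 := by linarith [hc.trace_eq_zero]
  obtain ⟨c, s, h, hcs⟩ := exists_isotropic (A := a4) (B := a5 + a7) (C := -a4)
    (by nlinarith [sq_nonneg (a5 + a7), sq_nonneg a4])
  have hr := hc.rotate c s h
  have key : ∀ {m n p q : ℝ}, IsCenter (sysDagger m n 0 p q 0) 0 → (p + q) * m * n = 0 := by
    intro m n p q hc
    have hd := hc.det_pos
    by_contra hne
    rcases lt_or_ge 0 p with hp | hp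
    · refine not_isCenter_of_lyapunov_quantity hp (q := -q) (by nlinarith) (m := m) (n := n) ?_
        (by simpa using hc)
      simpa using hne
    · have hp : p < 0 := hp.lt_of_ne (by rintro rfl; simp at hd)
      refine not_isCenter_of_lyapunov_quantity (p := -p) (q := q) (by linarith) (by nlinarith)
        (m := -m) (n := -n) ?_ (by simpa using hc.neg_sysDagger)
      intro h0
      exact hne (by linarith)
  have h4 : c ^ 2 * a4 + c * s * (a5 + a7) + s ^ 2 * -a4 = 0 := by linear_combination hcs
  have h8 : s ^ 2 * a4 - c * s * (a5 + a7) + c ^ 2 * -a4 = 0 := by linear_combination -hcs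
  rw [h4, h8] at hr
  have := key hr
  linear_combination this + (c * a1 + s * a2) ^ 2 * h4 + (-s * a1 + c * a2) ^ 2 * h8
    - (a4 * (a1 ^ 2 - a2 ^ 2) + a1 * a2 * (a5 + a7)) * (c ^ 2 + s ^ 2 + 1) * h

/-- A differentiable function with positive derivative and infinite limits at both ends is
invertible with differentiable inverse. -/
theorem exists_orderIso_of_hasDerivAt_pos {X X' : ℝ → ℝ} (hX : ∀ u, HasDerivAt X (X' u) u)
    (hpos : ∀ u, 0 < X' u) (htop : Tendsto X atTop atTop) (hbot : Tendsto X atBot atBot) :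
    ∃ e : ℝ ≃o ℝ, (∀ u, e u = X u) ∧ ∀ x, HasDerivAt e.symm (X' (e.symm x))⁻¹ x := by
  have hc : Continuous X := continuous_iff_continuousAt.2 fun u => (hX u).continuousAt
  have hm : StrictMono X := strictMono_of_hasDerivAt_pos hX hpos
  refine ⟨hm.orderIsoOfSurjective X (hc.surjective htop hbot), fun u => rfl, fun x => ?_⟩
  exact HasDerivAt.of_local_left_inverse (OrderIso.continuous _).continuousAt (hX _)
    (hpos _).ne' (Eventually.of_forall (hm.orderIsoOfSurjective X _).apply_symm_apply)

/-- The angular equation `θ' = g(θ)` with positive periodic right-hand side. -/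
theorem exists_angle {g : ℝ → ℝ} (hg : Continuous g) (hpos : ∀ s, 0 < g s) {P : ℝ} (hP : 0 < P)
    (hper : Function.Periodic g P) (θ₀ : ℝ) :
    ∃ (θ : ℝ → ℝ) (T : ℝ), θ 0 = θ₀ ∧ 0 < T ∧ Function.Surjective θ ∧
      (∀ t, HasDerivAt θ (g (θ t)) t) ∧ ∀ t, θ (t + T) = θ t + P := by
  have hgi : Continuous fun s => (g s)⁻¹ := hg.inv₀ fun s => (hpos s).ne'
  have hgper : Function.Periodic (fun s => (g s)⁻¹) P := fun s => by simp only [hper s]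
  have hint : ∀ a b, IntervalIntegrable (fun s => (g s)⁻¹) MeasureTheory.volume a b :=
    fun a b => hgi.intervalIntegrable a b
  obtain ⟨e, he, hd⟩ := exists_orderIso_of_hasDerivAt_pos
    (X := fun θ => ∫ s in (0 : ℝ)..θ, (g s)⁻¹)
    (fun u => hgi.integral_hasStrictDerivAt 0 u |>.hasDerivAt) (fun u => inv_pos.2 (hpos u))
    (hgper.tendsto_atTop_intervalIntegral_of_pos' (hint _ _) (fun s => inv_pos.2 (hpos s)) hP)
    (hgper.tendsto_atBot_intervalIntegral_of_pos' (hint _ _) (fun s => inv_pos.2 (hpos s)) hP)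
  refine ⟨fun t => e.symm (t + e θ₀), e P, by simp, ?_, fun θ => ⟨e θ - e θ₀, by simp⟩,
    fun t => ?_, fun t => ?_⟩
  · rw [he]
    exact intervalIntegral.intervalIntegral_pos_of_pos (hint _ _) (fun s => inv_pos.2 (hpos s)) hP
  · have := (hd (t + e θ₀)).comp_add_const t (e θ₀)
    rwa [inv_inv] at this
  · have h2 : e (e.symm (t + e θ₀) + P) = e (e.symm (t + e θ₀)) + e P := by
      rw [he, hgper.intervalIntegral_add_eq_add 0 _ hint, ← he, zero_add, ← he]
    rw [OrderIso.symm_apply_eq, h2, OrderIso.apply_symm_apply]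
    ring

theorem exists_polar (x y : ℝ) :
    ∃ θ : ℝ, x = √(x ^ 2 + y ^ 2) * Real.cos θ ∧ y = -(√(x ^ 2 + y ^ 2) * Real.sin θ) := by
  have hn : ‖(⟨x, -y⟩ : ℂ)‖ = √(x ^ 2 + y ^ 2) := by
    rw [Complex.norm_def, Complex.normSq_mk]; ring_nf
  refine ⟨Complex.arg ⟨x, -y⟩, ?_, ?_⟩
  · rw [← hn, Complex.norm_mul_cos_arg]
  · rw [← hn, Complex.norm_mul_sin_arg, neg_neg]

/-- A singular point around which the vector field is, in suitable global coordinates, a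
positive multiple of a rotation is a center. -/
theorem isCenter_of_rotation {f : ℝ × ℝ → ℝ × ℝ} (hf0 : f 0 = 0) (Ψ : (ℝ × ℝ) ≃ₜ (ℝ × ℝ))
    (hΨ0 : Ψ 0 = 0) {κ : ℝ → ℝ} (hκ : Continuous κ) (hκpos : ∀ x, 0 < κ x) {R : ℝ} (hR : 0 < R)
    (hsol : ∀ x y : ℝ → ℝ, (∀ t, HasDerivAt x (κ (x t) * y t) t) →
      (∀ t, HasDerivAt y (-(κ (x t) * x t)) t) → (∀ t, x t ^ 2 + y t ^ 2 < R ^ 2) →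
      IsSolution f fun t => Ψ.symm (x t, y t)) : IsCenter f 0 := by
  set F : ℝ × ℝ → ℝ := fun w => (Ψ w).1 ^ 2 + (Ψ w).2 ^ 2 with hF
  have hFc : Continuous F := by fun_prop
  have hF0 : F 0 = 0 := by simp [hF, hΨ0]
  refine ⟨hf0, {w | F w < R ^ 2}, (isOpen_lt hFc continuous_const).mem_nhds ?_, fun p hp hp0 => ?_⟩
  · rw [mem_ofPred_eq, hF0]; positivity
  obtain ⟨r, hrd⟩ : ∃ r, r = √((Ψ p).1 ^ 2 + (Ψ p).2 ^ 2) := ⟨_, rfl⟩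
  have hFp : 0 < F p := sum_sq_pos fun h => hp0 (Ψ.injective (h.trans hΨ0.symm))
  have hr : 0 < r := hrd ▸ Real.sqrt_pos.2 hFp
  have hr2 : r ^ 2 = F p := by rw [hrd]; exact Real.sq_sqrt hFp.le
  obtain ⟨θ₀, hx0, hy0⟩ := exists_polar (Ψ p).1 (Ψ p).2
  rw [← hrd] at hx0 hy0
  obtain ⟨θ, T, h0, hT, hsurj, hθ, hθT⟩ := exists_angle (g := fun s => κ (r * Real.cos s))
    (by fun_prop) (fun s => hκpos _) Real.two_pi_pos (fun s => by simp) θ₀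
  set x : ℝ → ℝ := fun t => r * Real.cos (θ t) with hx
  set y : ℝ → ℝ := fun t => -(r * Real.sin (θ t)) with hy
  have hxy : ∀ t, x t ^ 2 + y t ^ 2 = F p := fun t => by
    simp only [hx, hy]
    rw [← hr2]
    linear_combination r ^ 2 * Real.cos_sq_add_sin_sq (θ t)
  have hγ : IsSolution f fun t => Ψ.symm (x t, y t) := by
    refine hsol x y (fun t => ?_) (fun t => ?_) fun t => (hxy t).trans_lt hp
    · exact ((hθ t).cos.const_mul r).congr_deriv (by simp only [hx, hy]; ring)
    · exact ((hθ t).sin.const_mul r).neg.congr_deriv (by simp only [hx]; ring)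
  have hFγ : ∀ t, F (Ψ.symm (x t, y t)) = F p := fun t => by
    simp only [hF, Ψ.apply_symm_apply]; exact hxy t
  have hrange : ∀ w, F w = F p → w ∈ range fun t => Ψ.symm (x t, y t) := by
    intro w hw
    obtain ⟨φ, hφx, hφy⟩ := exists_polar (Ψ w).1 (Ψ w).2
    have hwr : √((Ψ w).1 ^ 2 + (Ψ w).2 ^ 2) = r := by rw [hrd]; exact congrArg _ hw
    rw [hwr] at hφx hφy
    obtain ⟨t, rfl⟩ := hsurj φ
    exact ⟨t, by rw [Ψ.symm_apply_eq, Prod.ext_iff]; exact ⟨hφx.symm, hφy.symm⟩⟩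
  refine ⟨fun t => Ψ.symm (x t, y t), T, ?_, hγ, hT, fun t => ?_, fun hc => ?_, ?_, ?_⟩
  · rw [Ψ.symm_apply_eq, Prod.ext_iff]
    simp only [hx, hy, h0]
    exact ⟨hx0.symm, hy0.symm⟩
  · simp only [hx, hy, hθT, Real.cos_add_two_pi, Real.sin_add_two_pi]
  · obtain ⟨t, ht⟩ := hsurj (θ 0 + Real.pi)
    have h1 := Prod.ext_iff.1 (Ψ.symm.injective (hc t))
    simp only [hx, hy, ht, Real.cos_add_pi, Real.sin_add_pi] at h1
    have h2 : x 0 = 0 := by simp only [hx]; linarith [h1.1]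
    have h3 : y 0 = 0 := by simp only [hy]; linarith [h1.2]
    have h4 := hxy 0
    rw [h2, h3] at h4
    norm_num at h4
    exact hFp.ne h4
  · rintro ⟨t, ht⟩
    have := hFγ t
    simp only at ht
    rw [ht, hF0] at this
    exact hFp.ne this
  · have hmem : (0 : ℝ × ℝ) ∈ (range fun t => Ψ.symm (x t, y t))ᶜ := by
      rintro ⟨t, ht⟩
      have := hFγ t
      simp only at ht
      rw [ht, hF0] at this
      exact hFp.ne this
    have hcomp : IsCompact (Ψ.symm '' Metric.closedBall 0 r) :=
      (isCompact_closedBall _ _).image Ψ.symm.continuous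
    refine hcomp.isBounded.subset fun w hw => ?_
    have hlt : F w < F p := isPreconnected_connectedComponentIn.gt_of_ne hFc.continuousOn
      (fun z hz hzF => absurd (hrange z hzF) (connectedComponentIn_subset _ _ hz))
      ⟨0, mem_connectedComponentIn hmem, by rwa [hF0]⟩ hw
    refine ⟨Ψ w, ?_, Ψ.symm_apply_apply w⟩
    rw [← hr2] at hlt
    rw [mem_closedBall_zero_iff]
    simp only [hF] at hlt
    refine max_le (abs_le_of_sq_le_sq ?_ hr.le) (abs_le_of_sq_le_sq ?_ hr.le)
    · nlinarith [sq_nonneg (Ψ w).2]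
    · nlinarith [sq_nonneg (Ψ w).1]

/-- The function `u ↦ sign u * √(∫₀ᵘ s k(s) ds)` is a diffeomorphism when `k` is positive. -/
theorem exists_sqrt_primitive {k : ℝ → ℝ} (hk : Continuous k) {m : ℝ} (hm : 0 < m)
    (hmk : ∀ s, m ≤ k s) :
    ∃ X X' : ℝ → ℝ, (∀ u, HasDerivAt X (X' u) u) ∧ Continuous X' ∧ (∀ u, 0 < X' u) ∧ X 0 = 0 ∧
      Tendsto X atTop atTop ∧ Tendsto X atBot atBot ∧ ∀ u, 2 * (X u * X' u) = u * k u := by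
  set J : ℝ → ℝ := fun u => ∫ τ in (0 : ℝ)..1, τ * k (τ * u) with hJ
  have hJc : Continuous J :=
    intervalIntegral.continuous_parametric_intervalIntegral_of_continuous' (by fun_prop) 0 1
  have hJm : ∀ u, m / 2 ≤ J u := fun u => by
    have h1 : ∫ τ in (0 : ℝ)..1, τ * m = m / 2 := by
      rw [intervalIntegral.integral_mul_const, integral_id]; ring
    rw [← h1]
    refine intervalIntegral.integral_mono_on zero_le_one
      (Continuous.intervalIntegrable (by fun_prop) _ _)
      (Continuous.intervalIntegrable (by fun_prop) _ _) fun τ hτ => ?_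
    exact mul_le_mul_of_nonneg_left (hmk _) hτ.1
  have hJpos : ∀ u, 0 < J u := fun u => (half_pos hm).trans_le (hJm u)
  have hG : ∀ u, u ^ 2 * J u = ∫ s in (0 : ℝ)..u, s * k s := fun u => by
    have h1 := intervalIntegral.mul_integral_comp_mul_right (a := 0) (b := 1)
      (f := fun s => s * k s) u
    rw [zero_mul, one_mul] at h1
    rw [← h1, sq, mul_assoc, hJ, ← intervalIntegral.integral_const_mul]
    congr 2
    funext τ
    ring
  have hGd : ∀ u, HasDerivAt (fun u => u ^ 2 * J u) (u * k u) u := fun u => by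
    rw [funext hG]
    exact (Continuous.integral_hasStrictDerivAt (f := fun s => s * k s) (by fun_prop) 0 u).hasDerivAt
  have hJ0 : J 0 = k 0 / 2 := by
    simp only [hJ, mul_zero, intervalIntegral.integral_mul_const, integral_id]
    ring
  refine ⟨fun u => u * √(J u), fun u => k u / (2 * √(J u)), fun u => ?_, ?_, fun u => ?_,
    by simp, ?_, ?_, fun u => ?_⟩
  · rcases eq_or_ne u 0 with rfl | hu
    · have h1 : k 0 / (2 * √(J 0)) = √(J 0) := by
        have h2 := Real.mul_self_sqrt (hJpos 0).le
        rw [div_eq_iff (by have := Real.sqrt_pos.2 (hJpos 0); positivity)]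
        linarith
      refine HasDerivAt.congr_deriv ?_ h1.symm
      rw [hasDerivAt_iff_tendsto_slope]
      refine ((hJc.sqrt.tendsto 0).mono_left nhdsWithin_le_nhds).congr' ?_
      filter_upwards [self_mem_nhdsWithin] with u hu
      rw [slope_def_field]
      have : u ≠ 0 := hu
      field_simp
      ring
    · have h1 : HasDerivAt J ((u * k u * u ^ 2 - u ^ 2 * J u * (2 * u)) / (u ^ 2) ^ 2) u := by
        have h2 := (hGd u).div (hasDerivAt_pow 2 u) (pow_ne_zero 2 hu)
        refine (h2.congr_of_eventuallyEq ?_).congr_deriv (by simp)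
        filter_upwards [eventually_ne_nhds hu] with v hv
        simp only [Pi.div_apply]
        field_simp
      refine ((hasDerivAt_id u).mul (h1.sqrt (hJpos u).ne')).congr_deriv ?_
      have h3 := Real.sqrt_pos.2 (hJpos u)
      have h4 := Real.sq_sqrt (hJpos u).le
      simp only [id]
      field_simp
      linear_combination 2 * h4
  · exact hk.div (by fun_prop) fun u => (mul_pos two_pos (Real.sqrt_pos.2 (hJpos u))).ne'
  · exact div_pos (hm.trans_le (hmk u)) (mul_pos two_pos (Real.sqrt_pos.2 (hJpos u)))
  · refine tendsto_atTop_mono' _ ?_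
      (tendsto_id.atTop_mul_const (Real.sqrt_pos.2 (half_pos hm)))
    filter_upwards [eventually_ge_atTop 0] with u hu
    exact mul_le_mul_of_nonneg_left (Real.sqrt_le_sqrt (hJm u)) hu
  · refine tendsto_atBot_mono' _ ?_
      (tendsto_id.atBot_mul_const (Real.sqrt_pos.2 (half_pos hm)))
    filter_upwards [eventually_le_atBot 0] with u hu
    exact mul_le_mul_of_nonpos_left (Real.sqrt_le_sqrt (hJm u)) hu
  · have h3 := Real.sqrt_pos.2 (hJpos u)
    field_simp

theorem isCenter_of_coordinates {f : ℝ × ℝ → ℝ × ℝ} (hf0 : f 0 = 0) {X X' N N' κ : ℝ → ℝ}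
    (hX : ∀ u, HasDerivAt X (X' u) u) (hX'pos : ∀ u, 0 < X' u) (hX0 : X 0 = 0)
    (htop : Tendsto X atTop atTop) (hbot : Tendsto X atBot atBot)
    (hN : ∀ u, HasDerivAt N (N' u) u) (hNpos : ∀ u, 0 < N u)
    (hκ : Continuous κ) (hκpos : ∀ u, 0 < κ u) {u₀ : ℝ} (hu₀ : 0 < u₀)
    (h1 : ∀ w : ℝ × ℝ, w.1 ∈ Icc (-u₀) u₀ → X' w.1 * (f w).1 = κ w.1 * (w.2 * N w.1))
    (h2 : ∀ w : ℝ × ℝ, w.1 ∈ Icc (-u₀) u₀ →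
      (f w).2 * N w.1 + w.2 * (N' w.1 * (f w).1) = -(κ w.1 * X w.1)) : IsCenter f 0 := by
  obtain ⟨e, he, hd⟩ := exists_orderIso_of_hasDerivAt_pos hX hX'pos htop hbot
  have hNc : Continuous N := continuous_iff_continuousAt.2 fun u => (hN u).continuousAt
  have hec : Continuous e := e.continuous
  have hes : Continuous e.symm := e.symm.continuous
  have he0 : e 0 = 0 := by rw [he, hX0]
  have hpos : 0 < e u₀ := he0 ▸ e.strictMono hu₀
  have hneg : e (-u₀) < 0 := he0 ▸ e.strictMono (neg_neg_of_pos hu₀)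
  let Ψ : (ℝ × ℝ) ≃ₜ (ℝ × ℝ) :=
    { toFun := fun w => (e w.1, w.2 * N w.1)
      invFun := fun z => (e.symm z.1, z.2 / N (e.symm z.1))
      left_inv := fun w => by simp [(hNpos _).ne']
      right_inv := fun z => by simp [(hNpos _).ne']
      continuous_toFun := by fun_prop
      continuous_invFun := (by fun_prop : Continuous fun z : ℝ × ℝ => e.symm z.1).prodMk
        (continuous_snd.div (by fun_prop) fun z => (hNpos _).ne') }
  refine isCenter_of_rotation hf0 Ψ (Prod.ext he0 (zero_mul _)) (κ := fun x => κ (e.symm x))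
    (hκ.comp hes) (fun x => hκpos _) (R := min (e u₀) (-e (-u₀))) (by simp [hpos, hneg]) ?_
  intro x y hx hy hxy t
  have hxlt : |x t| < min (e u₀) (-e (-u₀)) :=
    abs_lt_of_sq_lt_sq (by nlinarith [hxy t, sq_nonneg (y t)]) (by simp [hpos.le, hneg.le])
  rw [lt_min_iff, abs_lt, abs_lt, neg_neg] at hxlt
  have hmem : e.symm (x t) ∈ Icc (-u₀) u₀ :=
    ⟨e.le_symm_apply.2 hxlt.2.1.le, e.symm_apply_le.2 hxlt.1.2.le⟩
  have hu := (hd (x t)).comp t (hx t)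
  have hv := (hy t).div ((hN _).comp t hu) (hNpos _).ne'
  have e1 := h1 (Ψ.symm (x t, y t)) hmem
  have e2 := h2 (Ψ.symm (x t, y t)) hmem
  have hs : Ψ.symm (x t, y t) = (e.symm (x t), y t / N (e.symm (x t))) := rfl
  change HasDerivAt _ (f (Ψ.symm (x t, y t))) t
  rw [hs] at e1 e2 ⊢
  simp only [← he, OrderIso.apply_symm_apply] at e1 e2
  have hN0 := (hNpos (e.symm (x t))).ne'
  have hX0 := (hX'pos (e.symm (x t))).ne'
  rw [div_mul_cancel₀ _ hN0] at e1
  have e3 : (X' (e.symm (x t)))⁻¹ * (κ (e.symm (x t)) * y t)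
      = (f (e.symm (x t), y t / N (e.symm (x t)))).1 := by
    rw [← e1]; field_simp
  refine (hu.prodMk hv).congr_deriv (Prod.ext e3 ?_)
  simp only [Function.comp_apply]
  rw [e3, ← e2]
  field_simp
  ring

/-- A system `u̇ = v D(u)`, `v̇ = -u L(u) - c u v²` with `D, L > 0` near `0` has a center. -/
theorem isCenter_of_reversible {m p q : ℝ} (hp : 0 < p) (hq : 0 < q) :
    IsCenter (sysDagger m 0 0 (-p) q 0) 0 := by
  obtain ⟨c, hc⟩ : ∃ c, c = q - p := ⟨_, rfl⟩
  set D : ℝ → ℝ := fun u => p + m * u - c * u ^ 2 with hD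
  set L : ℝ → ℝ := fun u => q + m * u with hL
  have hDc : Continuous D := by fun_prop
  have hLc : Continuous L := by fun_prop
  obtain ⟨r, hr, hball⟩ := Metric.nhds_basis_closedBall.eventually_iff.1
    (((hDc.tendsto 0).eventually (lt_mem_nhds (show 0 < D 0 by simpa [hD] using hp))).and
      ((hLc.tendsto 0).eventually (lt_mem_nhds (show 0 < L 0 by simpa [hL] using hq))))
  rw [Real.closedBall_eq_Icc, zero_sub, zero_add] at hball
  set cl : ℝ → ℝ := fun u => max (-r) (min r u) with hcl
  have hclc : Continuous cl := by fun_prop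
  have hclm : ∀ u, cl u ∈ Icc (-r) r := fun u =>
    ⟨le_max_left _ _, max_le (by linarith) (min_le_left _ _)⟩
  have hcle : ∀ u ∈ Icc (-r) r, cl u = u := fun u hu => by
    simp only [hcl, min_eq_right hu.2, max_eq_right hu.1]
  have hDp : ∀ u, 0 < D (cl u) := fun u => (hball (hclm u)).1
  have hLp : ∀ u, 0 < L (cl u) := fun u => (hball (hclm u)).2
  have hnc : Continuous fun u => c * cl u / D (cl u) :=
    (continuous_const.mul hclc).div (hDc.comp hclc) fun u => (hDp u).ne'
  set N : ℝ → ℝ := fun u => Real.exp (∫ s in (0 : ℝ)..u, c * cl s / D (cl s)) with hN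
  have hNd : ∀ u, HasDerivAt N (N u * (c * cl u / D (cl u))) u := fun u =>
    (hnc.integral_hasStrictDerivAt 0 u).hasDerivAt.exp
  have hNp : ∀ u, 0 < N u := fun u => Real.exp_pos _
  have hNc : Continuous N := continuous_iff_continuousAt.2 fun u => (hNd u).continuousAt
  set k : ℝ → ℝ := fun u => 2 * N (cl u) ^ 2 * L (cl u) / D (cl u) with hk
  have hkc : Continuous k := (by fun_prop : Continuous fun u => 2 * N (cl u) ^ 2 * L (cl u)).div
    (hDc.comp hclc) fun u => (hDp u).ne'
  have hkp : ∀ u, 0 < k u := fun u =>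
    div_pos (mul_pos (mul_pos two_pos (pow_pos (hNp _) 2)) (hLp u)) (hDp u)
  obtain ⟨u₁, -, hmin⟩ := isCompact_Icc.exists_isMinOn (s := Icc (-r) r)
    (nonempty_Icc.2 (by linarith)) hkc.continuousOn
  obtain ⟨X, X', hX, hX'c, hX'p, hX0, htop, hbot, hXk⟩ :=
    exists_sqrt_primitive hkc (hkp u₁) fun s => by
      have h1 : k (cl s) = k s := by simp only [hk, hcle _ (hclm s)]
      exact h1 ▸ hmin (hclm s)
  refine isCenter_of_coordinates (by simp [sysDagger]) hX hX'p hX0 htop hbot hNd hNp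
    (κ := fun u => X' u * D (cl u) / N u) ?_ ?_ hr ?_ ?_
  · exact (hX'c.mul (hDc.comp hclc)).div hNc fun u => (hNp u).ne'
  · exact fun u => div_pos (mul_pos (hX'p u) (hDp u)) (hNp u)
  · intro w hw
    have hN0 := (hNp w.1).ne'
    simp only [hcle _ hw]
    field_simp
    simp only [sysDagger, hD, hc]
    ring
  · intro w hw
    have hN0 := (hNp w.1).ne'
    have hD0 := (hDp w.1).ne'
    have h1 := hXk w.1
    simp only [hk, hcle _ hw] at h1 hD0 ⊢
    have hf1 : (sysDagger m 0 0 (-p) q 0 w).1 = w.2 * D w.1 := by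
      simp only [sysDagger, hD, hc]; ring
    have hf2 : (sysDagger m 0 0 (-p) q 0 w).2 = -(w.1 * L w.1) - c * w.1 * w.2 ^ 2 := by
      simp only [sysDagger, hL, hc]; ring
    have h2 : X w.1 * X' w.1 = w.1 * (N w.1 ^ 2 * L w.1 / D w.1) := by
      linear_combination h1 / 2
    have h3 : X' w.1 * D w.1 / N w.1 * X w.1 = w.1 * (N w.1 * L w.1) := by
      calc _ = X w.1 * X' w.1 * D w.1 / N w.1 := by ring
        _ = _ := by rw [h2]; field_simp
    rw [hf1, hf2, h3]
    field_simp
    ring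

theorem exists_adapted_direction {a1 a2 a4 b : ℝ} (h : a4 * (a1 ^ 2 - a2 ^ 2) + a1 * a2 * b = 0) :
    ∃ c s : ℝ, c ^ 2 + s ^ 2 = 1 ∧ -s * a1 + c * a2 = 0 ∧
      a4 * c ^ 2 + b * (c * s) + -a4 * s ^ 2 = 0 := by
  rcases eq_or_ne (a1, a2) 0 with h0 | h0
  · obtain ⟨rfl, rfl⟩ := Prod.mk_eq_zero.1 h0
    obtain ⟨c, s, h1, h2⟩ := exists_isotropic (A := a4) (B := b) (C := -a4)
      (by nlinarith [sq_nonneg b, sq_nonneg a4])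
    exact ⟨c, s, h1, by ring, h2⟩
  · have hn : 0 < a1 ^ 2 + a2 ^ 2 := sum_sq_pos h0
    have hs : 0 < √(a1 ^ 2 + a2 ^ 2) := Real.sqrt_pos.2 hn
    have hsq := Real.sq_sqrt hn.le
    refine ⟨a1 / √(a1 ^ 2 + a2 ^ 2), a2 / √(a1 ^ 2 + a2 ^ 2), ?_, by ring, ?_⟩
    · rw [div_pow, div_pow, hsq, ← add_div, div_self hn.ne']
    · field_simp
      linear_combination h

theorem isCenter_sysDagger {a1 a2 a4 a5 a7 : ℝ} (hdet : a4 ^ 2 + a7 * a5 < 0)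
    (h : a4 * (a1 ^ 2 - a2 ^ 2) + a1 * a2 * (a5 + a7) = 0) :
    IsCenter (sysDagger a1 a2 a4 a5 a7 (-a4)) 0 := by
  have key : ∀ {m p q : ℝ}, p * q < 0 → IsCenter (sysDagger m 0 0 p q 0) 0 := by
    intro m p q hpq
    rcases lt_or_ge p 0 with hp | hp
    · simpa using isCenter_of_reversible (m := m) (p := -p) (q := q) (by linarith) (by nlinarith)
    · have hp : 0 < p := hp.lt_of_ne (by rintro rfl; simp at hpq)
      simpa using (isCenter_of_reversible (m := -m) (p := p) (q := -q) hp
        (by nlinarith)).neg_sysDagger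
  obtain ⟨c, s, hcs, h2, h4⟩ := exists_adapted_direction h
  have h5 : (-c * s * a4 + c ^ 2 * a5 - s ^ 2 * a7 + c * s * -a4)
      * (-c * s * a4 - s ^ 2 * a5 + c ^ 2 * a7 + c * s * -a4) < 0 := by
    refine lt_of_eq_of_lt ?_ hdet
    linear_combination (a4 ^ 2 + a7 * a5) * (c ^ 2 + s ^ 2 + 1) * hcs
      - (c ^ 2 * a4 + c * s * (a5 + a7) + s ^ 2 * -a4) * h4
  have hc := (key (m := c * a1 + s * a2) h5).rotate c (-s) (by rw [neg_sq, hcs])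
  convert hc using 2
  · linear_combination -a1 * hcs - s * h2
  · linear_combination -a2 * hcs + c * h2
  · linear_combination -a4 * (c ^ 2 + s ^ 2 + 1) * hcs + (c ^ 2 - s ^ 2) * h4
  · linear_combination -a5 * (c ^ 2 + s ^ 2 + 1) * hcs + 2 * c * s * h4
  · linear_combination -a7 * (c ^ 2 + s ^ 2 + 1) * hcs + 2 * c * s * h4
  · linear_combination a4 * (c ^ 2 + s ^ 2 + 1) * hcs - (c ^ 2 - s ^ 2) * h4

/-- (Theorem on centers.) The origin is a center of the planar system (†)
iff `a₈ = -a₄`, `a₄² + a₇a₅ < 0` and `a₄(a₁²-a₂²) + a₁a₂(a₅+a₇) = 0`. -/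
theorem stmt3 (a1 a2 a4 a5 a7 a8 : ℝ) :
    IsCenter (sysDagger a1 a2 a4 a5 a7 a8) (0, 0) ↔
      a8 = -a4 ∧ a4 ^ 2 + a7 * a5 < 0 ∧
        a4 * (a1 ^ 2 - a2 ^ 2) + a1 * a2 * (a5 + a7) = 0 := by
  rw [Prod.mk_zero_zero]
  refine ⟨fun hc => ?_, ?_⟩
  · obtain rfl : a8 = -a4 := by linarith [hc.trace_eq_zero]
    exact ⟨rfl, by nlinarith [hc.det_pos], hc.lyapunov_quantity_eq_zero⟩
  · rintro ⟨rfl, hdet, h⟩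
    exact isCenter_sysDagger hdet h
end

section
/- Consider the planar system (†) obtained by central projection at (0,0,−1) of a degree-2 homogeneous polynomial vector field on S² in normal form (★) with a₃ = a₆ = 0. If a₈ = −a₄, a₄² + a₅a₇ = 0, and (a₄,a₅,a₇,a₈) ≠ (0,0,0,0) (i.e. the origin is a nilpotent singularity of (†)), then (0,0) is not a center of (†). -/
/-- A differentiable periodic function cannot vanish at a point if its derivative is positive at
each of its zeros. -/
theorem false_of_periodic_of_deriv_pos {h h' : ℝ → ℝ} {T : ℝ} (hT : 0 < T)
    (hper : ∀ t, h (t + T) = h t) (hd : ∀ t, HasDerivAt h (h' t) t) (h0 : h 0 = 0)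
    (hpos : ∀ t, h t = 0 → 0 < h' t) : False := by
  have hneg : h (-T) = 0 := by
    have := hper (-T)
    rw [neg_add_cancel] at this
    rw [← this, h0]
  have hle : ∀ ⦃x⦄, x ∈ Set.Icc (-T) T → -h x ≤ 0 :=
    image_le_of_deriv_right_lt_deriv_boundary (f := fun t => -h t) (f' := fun t => -h' t)
      (B := fun _ => 0) (B' := fun _ => 0)
      (fun t _ => (hd t).neg.continuousAt.continuousWithinAt)
      (fun t _ => (hd t).neg.hasDerivWithinAt) (by simp [hneg]) (fun t => hasDerivAt_const t 0)
      (fun t _ ht => by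
        have := hpos t (by simpa using ht)
        linarith)
  have hmin : IsLocalMin h 0 := by
    filter_upwards [Icc_mem_nhds (neg_lt_zero.2 hT) hT] with x hx
    have := hle hx
    linarith
  exact (hpos 0 h0).ne' (hmin.hasDerivAt_eq_zero (hd 0))

/-- A solution of a scalar linear homogeneous differential equation with continuous coefficient
that vanishes at time `0` vanishes identically. -/
theorem eq_zero_of_hasDerivAt_mul {h g : ℝ → ℝ} (hg : Continuous g)
    (hd : ∀ t, HasDerivAt h (h t * g t) t) (h0 : h 0 = 0) (t : ℝ) : h t = 0 := by
  have hG : ∀ t, HasDerivAt (fun t => ∫ x in (0 : ℝ)..t, g x) (g t) t := fun t =>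
    hg.integral_hasStrictDerivAt 0 t |>.hasDerivAt
  have hprod : ∀ t, HasDerivAt (fun t => h t * Real.exp (-∫ x in (0 : ℝ)..t, g x)) 0 t := by
    intro t
    refine ((hd t).mul (hG t).neg.exp).congr_deriv ?_
    change _ * Real.exp (-_) + _ * (Real.exp (-_) * _) = 0
    ring
  have hconst := is_const_of_deriv_eq_zero (fun t => (hprod t).differentiableAt)
    (fun t => (hprod t).deriv) t 0
  simpa [h0, Real.exp_ne_zero] using hconst

/-- Any neighborhood of the origin contains a nonzero multiple of a given plane vector. -/
theorem exists_ne_zero_smul_mem {U : Set (ℝ × ℝ)} (hU : U ∈ nhds (0, 0)) (x y : ℝ) :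
    ∃ s : ℝ, s ≠ 0 ∧ (s * x, s * y) ∈ U := by
  have hc : Filter.Tendsto (fun s : ℝ => (s * x, s * y)) (nhds 0) (nhds (0, 0)) := by
    have : Continuous (fun s : ℝ => (s * x, s * y)) := by fun_prop
    simpa using this.tendsto 0
  have hev : ∀ᶠ s in nhdsWithin (0 : ℝ) {0}ᶜ, (s * x, s * y) ∈ U :=
    (hc.eventually_mem hU).filter_mono nhdsWithin_le_nhds
  obtain ⟨s, hs, hs0⟩ := (hev.and self_mem_nhdsWithin).exists
  exact ⟨s, hs0, hs⟩

/-- If the linear part of (†) is `w ↦ k ⟨n, w⟩ (n₂, -n₁)`, then the origin is not a center: the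
line `⟨n, w⟩ = 0` is either crossed in only one direction or consists of singular points. -/
theorem not_isCenter_sysDagger_of_rank_one (a1 a2 k n1 n2 : ℝ) (hn : 0 < n1 ^ 2 + n2 ^ 2) :
    ¬ IsCenter (sysDagger a1 a2 (-(k * n1 * n2)) (-(k * n2 ^ 2)) (k * n1 ^ 2) (k * n1 * n2))
      (0, 0) := by
  rintro ⟨-, U, hU, H⟩
  obtain ⟨s, hs, hsU⟩ := exists_ne_zero_smul_mem hU n2 (-n1)
  have hne : (s * n2, s * -n1) ≠ ((0, 0) : ℝ × ℝ) := by
    intro h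
    simp only [Prod.mk.injEq, mul_eq_zero, hs, false_or, neg_eq_zero] at h
    simp [h.1, h.2] at hn
  obtain ⟨γ, T, hγ0, hγ, hT, hper, hnc, hq, -⟩ := H _ hsU hne
  have hu := fun t => hasFDerivAt_fst.comp_hasDerivAt t (hγ t)
  have hv := fun t => hasFDerivAt_snd.comp_hasDerivAt t (hγ t)
  have hcont : Continuous γ := continuous_iff_continuousAt.2 fun t => (hγ t).continuousAt
  have hℓ : ∀ t, HasDerivAt (fun t => n1 * (γ t).1 + n2 * (γ t).2)
      ((n2 * (γ t).1 - n1 * (γ t).2) * (-(a1 * (γ t).1 + a2 * (γ t).2)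
        + k * (n1 * (γ t).1 + n2 * (γ t).2) ^ 2)) t := by
    intro t
    refine (((hu t).const_mul n1).add ((hv t).const_mul n2)).congr_deriv ?_
    simp only [sysDagger, ContinuousLinearMap.coe_fst', ContinuousLinearMap.coe_snd']
    ring
  have hℓ0 : n1 * (γ 0).1 + n2 * (γ 0).2 = 0 := by
    rw [hγ0]
    ring
  by_cases hL : a1 * n2 - a2 * n1 = 0
  · have hzero : ∀ t, n1 * (γ t).1 + n2 * (γ t).2 = 0 := by
      refine eq_zero_of_hasDerivAt_mul
        (g := fun t => (n2 * (γ t).1 - n1 * (γ t).2) * (-((a1 * n1 + a2 * n2) / (n1 ^ 2 + n2 ^ 2))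
          + k * (n1 * (γ t).1 + n2 * (γ t).2))) (by fun_prop) (fun t => ?_) hℓ0
      convert hℓ t using 1
      field_simp
      linear_combination (n2 * (γ t).1 - n1 * (γ t).2) ^ 2 * hL
    have hf : ∀ t, HasDerivAt γ 0 t := by
      intro t
      convert hγ t using 1
      have hLt : a1 * (γ t).1 + a2 * (γ t).2 = 0 := by
        have : (n1 ^ 2 + n2 ^ 2) * (a1 * (γ t).1 + a2 * (γ t).2) = 0 := by
          linear_combination (n2 * (γ t).1 - n1 * (γ t).2) * hL + (a1 * n1 + a2 * n2) * hzero t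
        exact (mul_eq_zero.1 this).resolve_left hn.ne'
      ext
      · simp only [sysDagger, Prod.fst_zero]
        linear_combination
          (-k * n2 - k * (n2 * (γ t).1 - n1 * (γ t).2) * (γ t).1) * hzero t - (γ t).2 * hLt
      · simp only [sysDagger, Prod.snd_zero]
        linear_combination
          (k * n1 - k * (n2 * (γ t).1 - n1 * (γ t).2) * (γ t).2) * hzero t + (γ t).1 * hLt
    exact hnc fun t => is_const_of_deriv_eq_zero (fun t => (hf t).differentiableAt)
      (fun t => (hf t).deriv) t 0
  · refine false_of_periodic_of_deriv_pos hT (fun t => ?_)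
      (fun t => (hℓ t).const_mul (-(a1 * n2 - a2 * n1))) (by simp [hℓ0]) (fun t ht => ?_)
    · simp only [hper t]
    · have hz : n1 * (γ t).1 + n2 * (γ t).2 = 0 :=
        (mul_eq_zero.1 ht).resolve_left (neg_ne_zero.2 hL)
      have hm : n2 * (γ t).1 - n1 * (γ t).2 ≠ 0 := by
        intro hm
        refine hq ⟨t, Prod.ext ?_ ?_⟩
        · have : (n1 ^ 2 + n2 ^ 2) * (γ t).1 = 0 := by linear_combination n1 * hz + n2 * hm
          exact (mul_eq_zero.1 this).resolve_left hn.ne'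
        · have : (n1 ^ 2 + n2 ^ 2) * (γ t).2 = 0 := by linear_combination n2 * hz - n1 * hm
          exact (mul_eq_zero.1 this).resolve_left hn.ne'
      refine pos_of_mul_pos_right (a := n1 ^ 2 + n2 ^ 2) ?_ hn.le
      have hpos : 0 < ((a1 * n2 - a2 * n1) * (n2 * (γ t).1 - n1 * (γ t).2)) ^ 2 := by positivity
      refine hpos.trans_eq ?_
      rw [hz]
      linear_combination
        -(a1 * n2 - a2 * n1) * (n2 * (γ t).1 - n1 * (γ t).2) * (a1 * n1 + a2 * n2) * hz

/-- If the origin is a nilpotent singularity of the planar system (†)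
(`a₈ = -a₄`, `a₄² + a₅a₇ = 0`, not all of `a₄,a₅,a₇,a₈` zero), then it is not a center. -/
theorem stmt4 (a1 a2 a4 a5 a7 a8 : ℝ) (h1 : a8 = -a4) (h2 : a4 ^ 2 + a5 * a7 = 0)
    (h3 : ¬ (a4 = 0 ∧ a5 = 0 ∧ a7 = 0 ∧ a8 = 0)) :
    ¬ IsCenter (sysDagger a1 a2 a4 a5 a7 a8) (0, 0) := by
  subst h1
  by_cases h5 : a5 = 0
  · subst h5
    have h4 : a4 = 0 := by simpa using h2
    subst h4
    simpa using not_isCenter_sysDagger_of_rank_one a1 a2 a7 1 0 (by norm_num)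
  · have h7 : a7 = -(a4 ^ 2 / a5) := by
      field_simp
      linear_combination h2
    have e4 : -(-(1 / a5) * a4 * a5) = a4 := by field_simp
    have e5 : -(-(1 / a5) * a5 ^ 2) = a5 := by field_simp
    have e7 : -(1 / a5) * a4 ^ 2 = a7 := by
      rw [h7]
      ring
    have e8 : -(1 / a5) * a4 * a5 = -a4 := by field_simp
    have := not_isCenter_sysDagger_of_rank_one a1 a2 (-(1 / a5)) a4 a5 (by positivity)
    rwa [e4, e5, e7, e8] at this
end

section
/- Let X=(P,Q,R) be a homogeneous polynomial vector field on S², and let X̄ = (P̃ + uR̃, Q̃ + vR̃) be the planar polynomial vector field obtained from X by stereographic projection from the point (0,0,1). Then f(u,v) = u²+v²+1 satisfies the polynomial identity (P̃+uR̃)·(∂f/∂u) + (Q̃+vR̃)·(∂f/∂v) = R̃·f, i.e. 2u(P̃+uR̃) + 2v(Q̃+vR̃) = R̃·(u²+v²+1); thus f = 0 is an invariant algebraic curve of X̄ with cofactor R̃. -/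
open MvPolynomial

/-- For `F ∈ ℝ[x,y,z]`, the function `F̃(u,v) = F(2u, 2v, u²+v²-1)`. -/
noncomputable def tilde (F : MvPolynomial (Fin 3) ℝ) (u v : ℝ) : ℝ :=
  eval ![2 * u, 2 * v, u ^ 2 + v ^ 2 - 1] F

/-- Evaluation of a homogeneous polynomial scales with the power given by its degree. -/
theorem MvPolynomial.IsHomogeneous.eval_const_mul {σ A : Type*} [CommSemiring A]
    {F : MvPolynomial σ A} {n : ℕ} (hF : F.IsHomogeneous n) (c : A) (p : σ → A) :
    eval (fun i => c * p i) F = c ^ n * eval p F := by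
  rw [eval_eq, eval_eq, Finset.mul_sum]
  refine Finset.sum_congr rfl fun d hd => ?_
  have hdeg : ∑ i ∈ d.support, d i = n := by
    rw [← hF (mem_support_iff.mp hd), Finsupp.weight_apply, Finsupp.sum]
    simp
  simp_rw [mul_pow]
  rw [Finset.prod_mul_distrib, Finset.prod_pow_eq_pow_sum, hdeg]
  ring

/-- A homogeneous vector field tangent to the unit sphere is tangent to every sphere centred at
the origin. -/
theorem radial_eq_zero_of_tangent {n : ℕ} {P Q R : MvPolynomial (Fin 3) ℝ}
    (hP : P.IsHomogeneous n) (hQ : Q.IsHomogeneous n) (hR : R.IsHomogeneous n)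
    (htan : ∀ p : Fin 3 → ℝ, p 0 ^ 2 + p 1 ^ 2 + p 2 ^ 2 = 1 →
      p 0 * eval p P + p 1 * eval p Q + p 2 * eval p R = 0)
    {r : ℝ} (hr : r ≠ 0) {w : Fin 3 → ℝ} (hw : w 0 ^ 2 + w 1 ^ 2 + w 2 ^ 2 = r ^ 2) :
    w 0 * eval w P + w 1 * eval w Q + w 2 * eval w R = 0 := by
  have h := htan (fun i => r⁻¹ * w i) (by
    simp_rw [mul_pow]
    rw [← mul_add, ← mul_add, hw, ← mul_pow, inv_mul_cancel₀ hr, one_pow])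
  rw [hP.eval_const_mul, hQ.eval_const_mul, hR.eval_const_mul] at h
  refine (mul_eq_zero.mp (?_ : r⁻¹ ^ (n + 1) * _ = 0)).resolve_left
    (pow_ne_zero _ (inv_ne_zero hr))
  linear_combination h

/-- For a homogeneous polynomial vector field `X = (P,Q,R)` on `S²`, the
stereographically projected planar field `X̄ = (P̃ + uR̃, Q̃ + vR̃)` admits
`f(u,v) = u² + v² + 1` as an invariant algebraic curve with cofactor `R̃`:
`2u(P̃ + uR̃) + 2v(Q̃ + vR̃) = R̃ · (u² + v² + 1)`. -/
theorem stmt7 (n : ℕ) (P Q R : MvPolynomial (Fin 3) ℝ)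
    (hP : P.IsHomogeneous n) (hQ : Q.IsHomogeneous n) (hR : R.IsHomogeneous n)
    (htan : ∀ p : Fin 3 → ℝ, p 0 ^ 2 + p 1 ^ 2 + p 2 ^ 2 = 1 →
      p 0 * eval p P + p 1 * eval p Q + p 2 * eval p R = 0) :
    ∀ u v : ℝ,
      (tilde P u v + u * tilde R u v) * (2 * u) + (tilde Q u v + v * tilde R u v) * (2 * v)
        = tilde R u v * (u ^ 2 + v ^ 2 + 1) := by
  intro u v
  have h := radial_eq_zero_of_tangent hP hQ hR htan
    (r := u ^ 2 + v ^ 2 + 1) (w := ![2 * u, 2 * v, u ^ 2 + v ^ 2 - 1]) (by positivity) (by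
      simp only [Matrix.cons_val]
      ring)
  simp only [Matrix.cons_val] at h
  simp only [tilde]
  linear_combination h
end

section
/- Let X=(P,Q,R) be a homogeneous polynomial vector field on S², let (a,b,c)∈S² with c≠0, and let X̄₁ = (P̃₁ − (u+a)𝒦̃₁, Q̃₁ − (v+b)𝒦̃₁) be the planar vector field obtained from X by central projection on the plane ax+by+cz=1. Then f₁(u,v) = (u+a)² + (v+b)² + (c − (au+bv)/c)² satisfies the identity X̄₁f₁ = (P̃₁ − (u+a)𝒦̃₁)·∂f₁/∂u + (Q̃₁ − (v+b)𝒦̃₁)·∂f₁/∂v = −2𝒦̃₁·f₁; thus f₁ = 0 is an invariant algebraic curve of X̄₁ with cofactor −2𝒦̃₁. -/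
open MvPolynomial

/-- The point `(u+a, v+b, c-(au+bv)/c)` of the plane `ax+by+cz = c²⁻…` (chart for `c ≠ 0`). -/
noncomputable def ch1 (a b c u v : ℝ) : Fin 3 → ℝ := ![u + a, v + b, c - (a * u + b * v) / c]

/-- The chart `(a-(bu+cv)/a, u+b, v+c)` (for `a ≠ 0`). -/
noncomputable def ch2 (a b c u v : ℝ) : Fin 3 → ℝ := ![a - (b * u + c * v) / a, u + b, v + c]

/-- The chart `(u+a, b-(au+cv)/b, v+c)` (for `b ≠ 0`). -/
noncomputable def ch3 (a b c u v : ℝ) : Fin 3 → ℝ := ![u + a, b - (a * u + c * v) / b, v + c]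

/-- The function `𝒦 = aP + bQ + cR` evaluated at a point `w`. -/
noncomputable def Kcal (P Q R : MvPolynomial (Fin 3) ℝ) (a b c : ℝ) (w : Fin 3 → ℝ) : ℝ :=
  a * eval w P + b * eval w Q + c * eval w R

/-- Evaluation of a homogeneous polynomial of degree `n` is homogeneous of degree `n`. -/
theorem eval_smul_of_isHomogeneous {σ K : Type*} [CommSemiring K] {n : ℕ} {F : MvPolynomial σ K}
    (hF : F.IsHomogeneous n) (t : K) (w : σ → K) : eval (t • w) F = t ^ n * eval w F := by
  simp only [eval_eq, Finset.mul_sum]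
  refine Finset.sum_congr rfl fun d hd => ?_
  rw [hF.degree_eq_sum_deg_support hd]
  simp only [Pi.smul_apply, smul_eq_mul, mul_pow, Finset.prod_mul_distrib,
    Finset.prod_pow_eq_pow_sum]
  ring

/-- A homogeneous polynomial vector field that is tangent to the unit sphere is orthogonal to the
position vector everywhere. -/
theorem tangent_of_tangent_on_sphere {n : ℕ} {P Q R : MvPolynomial (Fin 3) ℝ}
    (hP : P.IsHomogeneous n) (hQ : Q.IsHomogeneous n) (hR : R.IsHomogeneous n)
    (htan : ∀ p : Fin 3 → ℝ, p 0 ^ 2 + p 1 ^ 2 + p 2 ^ 2 = 1 →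
      p 0 * eval p P + p 1 * eval p Q + p 2 * eval p R = 0)
    (w : Fin 3 → ℝ) (hw : w ≠ 0) :
    w 0 * eval w P + w 1 * eval w Q + w 2 * eval w R = 0 := by
  have hpos : 0 < w 0 ^ 2 + w 1 ^ 2 + w 2 ^ 2 := by
    refine lt_of_le_of_ne (by positivity) fun h => hw ?_
    ext i
    fin_cases i <;> simp <;> nlinarith [sq_nonneg (w 0), sq_nonneg (w 1), sq_nonneg (w 2)]
  obtain ⟨r, hr, hrw⟩ : ∃ r : ℝ, 0 < r ∧ w 0 ^ 2 + w 1 ^ 2 + w 2 ^ 2 = r ^ 2 :=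
    ⟨_, Real.sqrt_pos.2 hpos, (Real.sq_sqrt hpos.le).symm⟩
  have key := htan (r⁻¹ • w) (by
    simp only [Pi.smul_apply, smul_eq_mul]
    field_simp
    exact hrw)
  simp only [eval_smul_of_isHomogeneous hP, eval_smul_of_isHomogeneous hQ,
    eval_smul_of_isHomogeneous hR, Pi.smul_apply, smul_eq_mul] at key
  have hne : r⁻¹ ^ (n + 1) ≠ 0 := by positivity
  refine (mul_eq_zero.1 ?_).resolve_left hne
  linear_combination key

/-- For a homogeneous polynomial vector field `X = (P,Q,R)` on `S²` and
`(a,b,c) ∈ S²` with `c ≠ 0`, the centrally projected planar field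
`X̄₁ = (P̃₁ - (u+a)𝒦̃₁, Q̃₁ - (v+b)𝒦̃₁)` admits
`f₁(u,v) = (u+a)² + (v+b)² + (c-(au+bv)/c)²` as an invariant algebraic curve with cofactor
`-2𝒦̃₁`, i.e. `X̄₁ f₁ = -2𝒦̃₁ · f₁`. -/
theorem stmt9 (n : ℕ) (P Q R : MvPolynomial (Fin 3) ℝ)
    (hP : P.IsHomogeneous n) (hQ : Q.IsHomogeneous n) (hR : R.IsHomogeneous n)
    (htan : ∀ p : Fin 3 → ℝ, p 0 ^ 2 + p 1 ^ 2 + p 2 ^ 2 = 1 →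
      p 0 * eval p P + p 1 * eval p Q + p 2 * eval p R = 0)
    (a b c : ℝ) (habc : a ^ 2 + b ^ 2 + c ^ 2 = 1) (hc : c ≠ 0) :
    ∀ u v : ℝ,
      (eval (ch1 a b c u v) P - (u + a) * Kcal P Q R a b c (ch1 a b c u v)) *
          deriv (fun s => (s + a) ^ 2 + (v + b) ^ 2 + (c - (a * s + b * v) / c) ^ 2) u
        + (eval (ch1 a b c u v) Q - (v + b) * Kcal P Q R a b c (ch1 a b c u v)) *
          deriv (fun s => (u + a) ^ 2 + (s + b) ^ 2 + (c - (a * u + b * s) / c) ^ 2) v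
        = -2 * Kcal P Q R a b c (ch1 a b c u v) *
            ((u + a) ^ 2 + (v + b) ^ 2 + (c - (a * u + b * v) / c) ^ 2) := by
  intro u v
  have hplane : a * (u + a) + b * (v + b) + c * (c - (a * u + b * v) / c) = 1 := by
    field_simp
    linear_combination habc
  have hw : ch1 a b c u v ≠ 0 := by
    intro h
    have h0 : u + a = 0 := congrFun h 0
    have h1 : v + b = 0 := congrFun h 1
    have h2 : c - (a * u + b * v) / c = 0 := congrFun h 2
    rw [h0, h1, h2] at hplane
    norm_num at hplane
  have horth : (u + a) * eval (ch1 a b c u v) P + (v + b) * eval (ch1 a b c u v) Q +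
      (c - (a * u + b * v) / c) * eval (ch1 a b c u v) R = 0 :=
    tangent_of_tangent_on_sphere hP hQ hR htan _ hw
  have hdu : HasDerivAt (fun s => (s + a) ^ 2 + (v + b) ^ 2 + (c - (a * s + b * v) / c) ^ 2)
      (2 * (u + a) - 2 * (c - (a * u + b * v) / c) * (a / c)) u := by
    have h := ((((hasDerivAt_id u).add_const a).pow 2).add_const ((v + b) ^ 2)).add
      ((((((hasDerivAt_id u).const_mul a).add_const (b * v)).div_const c).const_sub c).pow 2)
    refine h.congr_deriv ?_
    simp only [id_eq, Nat.cast_ofNat]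
    ring
  have hdv : HasDerivAt (fun s => (u + a) ^ 2 + (s + b) ^ 2 + (c - (a * u + b * s) / c) ^ 2)
      (2 * (v + b) - 2 * (c - (a * u + b * v) / c) * (b / c)) v := by
    have h := ((((hasDerivAt_id v).add_const b).pow 2).const_add ((u + a) ^ 2)).add
      ((((((hasDerivAt_id v).const_mul b).const_add (a * u)).div_const c).const_sub c).pow 2)
    refine h.congr_deriv ?_
    simp only [id_eq, Nat.cast_ofNat]
    ring
  rw [hdu.deriv, hdv.deriv, Kcal]
  generalize c - (a * u + b * v) / c = z at *
  generalize eval (ch1 a b c u v) P = p at *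
  generalize eval (ch1 a b c u v) Q = q at *
  generalize eval (ch1 a b c u v) R = r at *
  field_simp
  linear_combination c * horth + z * (a * p + b * q + c * r) * hplane
end

section
/- Let X=(P,Q,R) be a homogeneous polynomial vector field on S² of degree n. If X has finitely many singularities on S², then X has at most 2(n²−n+1) singularities on S². -/
open MvPolynomial

/-- The sphere `S² ⊆ ℝ³`. -/
def S2 : Set (Fin 3 → ℝ) := {p | p 0 ^ 2 + p 1 ^ 2 + p 2 ^ 2 = 1}

namespace Polynomial

theorem natDegree_det_le_of_weights {R ι : Type*} [CommRing R] [Fintype ι] [DecidableEq ι]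
    (M : Matrix ι ι R[X]) (a b : ι → ℕ) (D : ℕ)
    (h : ∀ i j, M i j ≠ 0 → (M i j).natDegree + a i ≤ b j)
    (hD : ∑ j, b j ≤ D + ∑ i, a i) : M.det.natDegree ≤ D := by
  rw [Matrix.det_apply]
  refine natDegree_sum_le_of_forall_le _ _ fun σ _ => ?_
  by_cases h0 : ∃ i, M (σ i) i = 0
  · obtain ⟨i, hi⟩ := h0
    have hz : ∏ i, M (σ i) i = 0 := Finset.prod_eq_zero (Finset.mem_univ i) hi
    rw [hz]
    simp
  · push Not at h0
    refine (natDegree_smul_le _ _).trans ((natDegree_prod_le _ _).trans ?_)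
    have h1 : ∑ i, ((M (σ i) i).natDegree + a (σ i)) ≤ ∑ i, b i :=
      Finset.sum_le_sum fun i _ => h _ _ (h0 i)
    rw [Finset.sum_add_distrib, Equiv.sum_comp σ a] at h1
    change ∑ i, (M (σ i) i).natDegree ≤ D
    omega

theorem natDegree_resultant_le {R : Type*} [CommRing R] (f g : R[X][X]) (m n N D : ℕ)
    (hf : ∀ k, f.coeff k ≠ 0 → (f.coeff k).natDegree + k ≤ N)
    (hg : ∀ k, g.coeff k ≠ 0 → (g.coeff k).natDegree + k ≤ N)
    (hD : (m + n) * N ≤ D + m * n) : (f.resultant g m n).natDegree ≤ D := by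
  rw [resultant]
  refine natDegree_det_le_of_weights (sylvester f g m n) (fun i => (i : ℕ))
    (Fin.addCases (motive := fun _ => ℕ) (fun j => N + j) (fun j => N + j)) D ?_ ?_
  · intro i j
    induction j using Fin.addCases with
    | left j =>
      simp only [sylvester, Matrix.of_apply, Fin.addCases_left]
      split_ifs with hij
      · intro h0
        have := hg _ h0
        have := hij.1
        omega
      · simp
    | right j =>
      simp only [sylvester, Matrix.of_apply, Fin.addCases_right]
      split_ifs with hij
      · intro h0
        have := hf _ h0
        have := hij.1
        omega
      · simp
  · simp only [Fin.sum_univ_add, Fin.addCases_left, Fin.addCases_right, Finset.sum_add_distrib,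
      Fin.val_castAdd, Fin.val_natAdd, Finset.sum_const, Finset.card_univ, Fintype.card_fin,
      smul_eq_mul]
    linarith

theorem exists_irreducible_dvd_of_resultant_eq_zero {R : Type*} [CommRing R] [IsDomain R]
    [IsIntegrallyClosed R] {f g : R[X]} (hf : f.Monic) {n : ℕ} (hg : g.natDegree ≤ n)
    (h : f.resultant g f.natDegree n = 0) :
    ∃ d : R[X], d.Monic ∧ Irreducible d ∧ d ∣ f ∧ d ∣ g := by
  classical
  let K := FractionRing R
  have hinj : Function.Injective (algebraMap R K) := IsFractionRing.injective R K
  obtain ⟨k, rfl⟩ := Nat.exists_eq_add_of_le hg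
  rw [resultant_add_right_deg _ _ _ _ _ le_rfl, hf.coeff_natDegree, one_pow, one_mul] at h
  have h1 : resultant (f.map (algebraMap R K)) (g.map (algebraMap R K)) = 0 := by
    rw [natDegree_map_eq_of_injective hinj, natDegree_map_eq_of_injective hinj,
      resultant_map_map, h, map_zero]
  obtain ⟨-, h2⟩ := resultant_eq_zero_iff.1 h1
  have hf0 : f.map (algebraMap R K) ≠ 0 := (hf.map _).ne_zero
  rw [← EuclideanDomain.gcd_isUnit_iff] at h2
  obtain ⟨π, hπ, hπd⟩ := WfDvdMonoid.exists_irreducible_factor h2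
    (fun h0 => hf0 (EuclideanDomain.gcd_eq_zero_iff.1 h0).1)
  have hπf := hπd.trans (EuclideanDomain.gcd_dvd_left _ _)
  have hπg := hπd.trans (EuclideanDomain.gcd_dvd_right _ _)
  obtain ⟨d, hd⟩ := IsIntegrallyClosed.eq_map_mul_C_of_dvd K hf hπf
  have hlc : IsUnit (C π.leadingCoeff) := by
    rw [isUnit_C]; exact (leadingCoeff_ne_zero.2 hπ.ne_zero).isUnit
  have hass : Associated (d.map (algebraMap R K)) π := by
    rw [← hd]
    exact (associated_mul_unit_right _ _ hlc)
  have hdm : d.Monic := by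
    apply monic_of_injective hinj
    have := congrArg leadingCoeff hd
    rw [leadingCoeff_mul, leadingCoeff_C] at this
    exact mul_right_cancel₀ (leadingCoeff_ne_zero.2 hπ.ne_zero) (by rw [this, one_mul])
  refine ⟨d, hdm, ?_, ?_, ?_⟩
  · rw [hdm.irreducible_iff_irreducible_map_fraction_map (K := K)]
    exact hass.symm.irreducible hπ
  · exact (map_dvd_map _ hinj hdm).1 (hass.dvd.trans hπf)
  · exact (map_dvd_map _ hinj hdm).1 (hass.dvd.trans hπg)

theorem eval_resultant_eq_zero {R : Type*} [CommRing R] {f g : R[X][X]} {m n : ℕ}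
    (hf : f.natDegree ≤ m) (hg : g.natDegree ≤ n) (hm : m ≠ 0) {x y : R}
    (hfx : f.evalEval x y = 0) (hgx : g.evalEval x y = 0) :
    (f.resultant g m n).eval x = 0 := by
  obtain ⟨a, b, -, -, h⟩ := exists_mul_add_mul_eq_C_resultant f g hf hg (Or.inl hm)
  have := congrArg (evalEval x y) h
  rw [evalEval_add, evalEval_mul, evalEval_mul, hfx, hgx, evalEval_C] at this
  simpa using this.symm

/-- The substitution `y ↦ t`, `z ↦ z t`; the `t`-degree of the image of `f` is the total degree
of `f`. -/
noncomputable def gradingHom (R : Type*) [CommRing R] : R[X][X] →+* R[X][X] :=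
  eval₂RingHom (eval₂RingHom (C.comp C) X) (C X * X)

theorem coeff_gradingHom {R : Type*} [CommRing R] (f : R[X][X]) (j k : ℕ) :
    ((gradingHom R f).coeff (j + k)).coeff k = (f.coeff k).coeff j := by
  induction f using Polynomial.induction_on' with
  | add f g hf hg => simp [hf, hg]
  | monomial k' c =>
    induction c using Polynomial.induction_on' with
    | add f g hf hg => simp only [map_add, coeff_add, hf, hg]
    | monomial j' a =>
      have : gradingHom R (monomial k' (monomial j' a)) =
          C (C a * X ^ k') * X ^ (j' + k') := by
        simp only [gradingHom, coe_eval₂RingHom, eval₂_monomial, RingHom.comp_apply]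
        rw [mul_pow, C_mul, C_pow, pow_add]
        ring
      rw [this, coeff_C_mul_X_pow, coeff_monomial]
      by_cases hk : k = k'
      · subst hk
        by_cases hj : j = j'
        · subst hj
          simp
        · rw [if_neg (by omega), if_pos rfl, coeff_monomial, if_neg (Ne.symm hj), coeff_zero]
      · rw [if_neg (Ne.symm hk), coeff_zero]
        split_ifs
        · rw [coeff_C_mul_X_pow, if_neg hk]
        · simp

theorem gradingHom_injective (R : Type*) [CommRing R] : Function.Injective (gradingHom R) := by
  intro f g h
  ext k j
  rw [← coeff_gradingHom, h, coeff_gradingHom]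

/-- The total degree of a polynomial in two variables. -/
noncomputable def bidegree {R : Type*} [CommRing R] (f : R[X][X]) : ℕ :=
  (gradingHom R f).natDegree

theorem natDegree_coeff_add_le_bidegree {R : Type*} [CommRing R] (f : R[X][X]) (k : ℕ)
    (h : f.coeff k ≠ 0) : (f.coeff k).natDegree + k ≤ f.bidegree := by
  apply le_natDegree_of_ne_zero
  intro h0
  have := coeff_gradingHom f (f.coeff k).natDegree k
  rw [h0, coeff_zero, coeff_natDegree] at this
  exact h (leadingCoeff_eq_zero.1 this.symm)

theorem natDegree_le_bidegree {R : Type*} [CommRing R] (f : R[X][X]) :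
    f.natDegree ≤ f.bidegree := by
  by_cases h : f = 0
  · simp [h]
  · exact le_of_add_le_right (natDegree_coeff_add_le_bidegree f _ (by simpa using h))

theorem bidegree_mul {R : Type*} [CommRing R] [IsDomain R] {f g : R[X][X]} (hf : f ≠ 0)
    (hg : g ≠ 0) : (f * g).bidegree = f.bidegree + g.bidegree := by
  rw [bidegree, map_mul, natDegree_mul]
  · rfl
  · rwa [Ne, map_eq_zero_iff _ (gradingHom_injective R)]
  · rwa [Ne, map_eq_zero_iff _ (gradingHom_injective R)]

theorem bidegree_zero {R : Type*} [CommRing R] : (0 : R[X][X]).bidegree = 0 := by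
  simp [bidegree]

theorem continuous_evalEval (f : ℝ[X][X]) :
    Continuous fun v : ℝ × ℝ => f.evalEval v.1 v.2 := by
  induction f using Polynomial.induction_on' with
  | add f g hf hg => 
    simp only [evalEval_add]
    exact hf.add hg
  | monomial k c =>
    simp only [← C_mul_X_pow_eq_monomial, evalEval_mul, evalEval_C, evalEval_pow, evalEval_X]
    fun_prop

theorem evalEval_derivative_eq_zero_of_finite {f : ℝ[X][X]}
    (hfin : {v : ℝ × ℝ | f.evalEval v.1 v.2 = 0}.Finite) {y z : ℝ} (h : f.evalEval y z = 0) :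
    f.derivative.evalEval y z = 0 := by
  have hconn : IsPreconnected {v : ℝ × ℝ | f.evalEval v.1 v.2 = 0}ᶜ := by
    refine (hfin.countable.isPathConnected_compl_of_one_lt_rank ?_).isConnected.isPreconnected
    rw [← Module.finrank_eq_rank]
    norm_cast
    simp [Module.finrank_prod]
  have himg := (hconn.image _ (continuous_evalEval f).continuousOn).ordConnected
  have hsign : (∀ v : ℝ × ℝ, 0 ≤ f.evalEval v.1 v.2) ∨ (∀ v : ℝ × ℝ, f.evalEval v.1 v.2 ≤ 0) := by
    by_contra! hc
    obtain ⟨⟨u, hu⟩, ⟨v, hv⟩⟩ := hc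
    obtain ⟨w, hw, hw0⟩ := himg.out ⟨u, hu.ne, rfl⟩ ⟨v, hv.ne', rfl⟩ ⟨hu.le, hv.le⟩
    exact hw hw0
  have heq : ∀ t, f.evalEval y t = (f.map (evalRingHom y)).eval t := fun t => by
    rw [← map_evalRingHom_eval]
  have hder : f.derivative.evalEval y z = (f.map (evalRingHom y)).derivative.eval z := by
    rw [derivative_map, map_evalRingHom_eval]
  rw [hder]
  rcases hsign with hs | hs
  · refine IsLocalMin.hasDerivAt_eq_zero (Filter.Eventually.of_forall fun t => ?_)
      ((f.map (evalRingHom y)).hasDerivAt z)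
    rw [← heq, ← heq, h]
    exact hs (y, t)
  · refine IsLocalMax.hasDerivAt_eq_zero (Filter.Eventually.of_forall fun t => ?_)
      ((f.map (evalRingHom y)).hasDerivAt z)
    rw [← heq, ← heq, h]
    exact hs (y, t)

theorem card_le_natDegree_of_eval_eq_zero {R : Type*} [CommRing R] [IsDomain R] {f : R[X]}
    (hf : f ≠ 0) (s : Finset R) (h : ∀ x ∈ s, f.eval x = 0) : s.card ≤ f.natDegree := by
  classical
  refine (Finset.card_le_card (t := f.roots.toFinset) fun x hx => ?_).trans
    ((Multiset.toFinset_card_le _).trans (card_roots' f))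
  rw [Multiset.mem_toFinset, mem_roots hf]
  exact h x hx

theorem card_le_sq_of_irreducible_of_finite {g : ℝ[X][X]} (hg : g.Monic) (hirr : Irreducible g)
    (hdeg : g.bidegree ≤ g.natDegree)
    (hfin : {v : ℝ × ℝ | g.evalEval v.1 v.2 = 0}.Finite) (s : Finset ℝ)
    (hs : ∀ y ∈ s, ∃ z, g.evalEval y z = 0) : s.card ≤ g.natDegree ^ 2 := by
  have hpos : g.natDegree ≠ 0 := fun h0 => hirr.not_isUnit (by
    rw [hg.natDegree_eq_zero.1 h0]; exact isUnit_one)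
  have hdle : g.derivative.natDegree ≤ g.natDegree - 1 := natDegree_derivative_le g
  have hres : g.resultant g.derivative g.natDegree (g.natDegree - 1) ≠ 0 := by
    intro h0
    obtain ⟨d, hdm, hd, hdg, hdd⟩ := exists_irreducible_dvd_of_resultant_eq_zero hg hdle h0
    have h1 : g ∣ g.derivative := ((hd.dvd_comm hirr).1 hdg).trans hdd
    have h2 : g.derivative ≠ 0 := by
      intro h
      exact hpos (derivative_eq_zero.1 h)
    have h3 := natDegree_le_of_dvd h1 h2
    omega
  refine (card_le_natDegree_of_eval_eq_zero hres s fun y hy => ?_).trans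
    (natDegree_resultant_le _ _ _ _ g.natDegree _ ?_ ?_ ?_)
  · obtain ⟨z, hz⟩ := hs y hy
    exact eval_resultant_eq_zero le_rfl hdle hpos hz
      (evalEval_derivative_eq_zero_of_finite hfin hz)
  · exact fun k hk => (natDegree_coeff_add_le_bidegree g k hk).trans hdeg
  · intro k hk
    rw [coeff_derivative] at hk ⊢
    have := natDegree_coeff_add_le_bidegree g (k + 1) (left_ne_zero_of_mul hk)
    have h1 : (g.coeff (k + 1) * ((k : ℝ[X]) + 1)).natDegree ≤ (g.coeff (k + 1)).natDegree := by
      refine natDegree_mul_le.trans ?_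
      rw [← Nat.cast_add_one, natDegree_natCast, add_zero]
    omega
  · obtain ⟨d, hd⟩ := Nat.exists_eq_succ_of_ne_zero hpos
    rw [hd, Nat.succ_sub_one]
    nlinarith

theorem X_pow_dvd_resultant {p q r : ℝ[X][X]} {n : ℕ} (hn : n ≠ 0) (hp : p.natDegree ≤ n)
    (hq : q.natDegree ≤ n) (hr : r.natDegree ≤ n - 1) (h : p + C X * q + X * r = 0)
    (hq0 : (q.coeff 0).coeff 0 ≠ 0) :
    X ^ (n - 1) ∣ p.resultant r n (n - 1) := by
  obtain ⟨m, rfl⟩ := Nat.exists_eq_succ_of_ne_zero hn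
  simp only [Nat.succ_eq_add_one, Nat.add_sub_cancel] at *
  have h1 : p.resultant (X * r) (m + 1) (1 + m) =
      p.resultant X (m + 1) 1 * p.resultant r (m + 1) m := by
    obtain ⟨k, rfl⟩ := Nat.exists_eq_add_of_le hr
    rw [← add_assoc, resultant_add_right_deg _ _ _ _ _ (natDegree_mul_le.trans (by simp)),
      resultant_add_right_deg p r _ _ _ le_rfl]
    have := resultant_mul_right p X r _ hp
    rw [natDegree_X] at this
    rw [this]
    ring
  have h2 : p.resultant X (m + 1) 1 = (-1) ^ (m + 1) * p.coeff 0 := by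
    have := resultant_X_pow_right p (m + 1) 1 hp
    rwa [pow_one, pow_one, mul_one] at this
  have h3 : p.coeff 0 = - (X * q.coeff 0) := by
    have := congrArg (fun f => coeff f 0) h
    simp only [coeff_add, coeff_C_mul, coeff_X_mul_zero, coeff_zero, add_zero] at this
    exact eq_neg_of_add_eq_zero_left this
  have h4 : X * r = C (-X) * q + p * (-1) := by
    rw [C_neg]
    linear_combination h
  have h5 : p.resultant (X * r) (m + 1) (1 + m) =
      (-X) ^ (m + 1) * p.resultant q (m + 1) (1 + m) := by
    rw [h4, resultant_add_mul_right _ _ _ _ _ (by simp [add_comm]) hp, resultant_C_mul_right]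
  rw [h1, h2, h3] at h5
  have h6 : X * (q.coeff 0 * p.resultant r (m + 1) m) =
      X * (X ^ m * -p.resultant q (m + 1) (1 + m)) := by
    rw [neg_pow (X : ℝ[X]), mul_assoc, mul_assoc] at h5
    have h7 := mul_left_cancel₀ (pow_ne_zero _ (neg_ne_zero.2 one_ne_zero)) h5
    linear_combination -h7
  have h8 : X ^ m ∣ q.coeff 0 * p.resultant r (m + 1) m := ⟨_, mul_left_cancel₀ X_ne_zero h6⟩
  refine prime_X.pow_dvd_of_dvd_mul_left m ?_ h8
  rwa [X_dvd_iff]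

theorem ne_zero_of_monic_of_add_eq_zero {p q r : ℝ[X][X]} {n : ℕ} (hp : p.Monic)
    (hpn : p.natDegree = n) (h : p + C X * q + X * r = 0) : n ≠ 0 := by
  rintro rfl
  rw [hp.natDegree_eq_zero.1 hpn] at h
  have := congrArg (evalEval 0 0) h
  simp [evalEval_mul, evalEval_C] at this

theorem natDegree_le_sub_one {p q r : ℝ[X][X]} {n : ℕ} (hp : p.bidegree ≤ n)
    (hq : q.bidegree ≤ n) (hr : r.bidegree ≤ n) (h : p + C X * q + X * r = 0) :
    r.natDegree ≤ n - 1 := by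
  rw [natDegree_le_iff_coeff_eq_zero]
  intro k hk
  by_cases hkn : k = n
  · subst hkn
    have := congrArg (fun f => coeff f (k + 1)) h
    simp only [coeff_add, coeff_C_mul, coeff_X_mul, coeff_zero] at this
    rwa [coeff_eq_zero_of_natDegree_lt (by linarith [natDegree_le_bidegree p]),
      coeff_eq_zero_of_natDegree_lt (by linarith [natDegree_le_bidegree q]), mul_zero,
      zero_add, zero_add] at this
  · exact coeff_eq_zero_of_natDegree_lt (by have := natDegree_le_bidegree r; omega)

theorem bidegree_le_of_mul {g q : ℝ[X][X]} (hg : g ≠ 0) {m n : ℕ} (hn : n ≤ g.bidegree + m)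
    (h : (g * q).bidegree ≤ n) : q.bidegree ≤ m := by
  by_cases hq : q = 0
  · simp [hq, bidegree_zero]
  · rw [bidegree_mul hg hq] at h
    omega

/-- Affine form of the bound: `p dx + q dy + r dz` with `p + y q + z r = 0` is a projective
one-form written in the chart `x = 1`, and `s` is a set of first coordinates of singular points. -/
theorem card_add_le_sq_add_one (n : ℕ) : ∀ p q r : ℝ[X][X], p.Monic → p.natDegree = n →
    p.bidegree ≤ n → q.bidegree ≤ n → r.bidegree ≤ n → p + C X * q + X * r = 0 →
    (q.coeff 0).coeff 0 ≠ 0 →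
    {v : ℝ × ℝ | p.evalEval v.1 v.2 = 0 ∧ q.evalEval v.1 v.2 = 0 ∧
      r.evalEval v.1 v.2 = 0}.Finite →
    ∀ s : Finset ℝ, (∀ y ∈ s, y ≠ 0 ∧ ∃ z, p.evalEval y z = 0 ∧ q.evalEval y z = 0 ∧
      r.evalEval y z = 0) → s.card + n ≤ n ^ 2 + 1 := by
  induction n using Nat.strong_induction_on with
  | _ n ih =>
  intro p q r hp hpn hpd hqd hrd h hq0 hfin s hs
  have hn := ne_zero_of_monic_of_add_eq_zero hp hpn h
  have hrn := natDegree_le_sub_one hpd hqd hrd h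
  by_cases hres : p.resultant r n (n - 1) = 0
  · rw [← hpn] at hres
    rw [← hpn] at hrn
    obtain ⟨g, hgm, hg, ⟨p', rfl⟩, ⟨r', rfl⟩⟩ :=
      exists_irreducible_dvd_of_resultant_eq_zero hp hrn hres
    have hgpos : g.natDegree ≠ 0 := fun h0 => hg.not_isUnit (by
      rw [hgm.natDegree_eq_zero.1 h0]; exact isUnit_one)
    have hgq : g ∣ q := by
      have h1 : g ∣ C X * q := ⟨-p' - X * r', by linear_combination h⟩
      refine (hg.prime.dvd_or_dvd h1).resolve_left fun h2 => ?_
      have := natDegree_le_of_dvd h2 (C_ne_zero.2 X_ne_zero)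
      rw [natDegree_C] at this
      omega
    obtain ⟨q', rfl⟩ := hgq
    have hp' : p'.Monic := hgm.of_mul_monic_left hp
    rw [hgm.natDegree_mul hp'] at hpn
    have hbg := natDegree_le_bidegree g
    have hbp := natDegree_le_bidegree p'
    have hbgp := bidegree_mul hgm.ne_zero hp'.ne_zero
    have hle : n ≤ g.bidegree + p'.natDegree := by omega
    have h' : p' + C X * q' + X * r' = 0 := by
      have : g * (p' + C X * q' + X * r') = 0 := by linear_combination h
      exact (mul_eq_zero.1 this).resolve_left hgm.ne_zero
    have hn' := ne_zero_of_monic_of_add_eq_zero hp' rfl h'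
    classical
    set s₁ := s.filter fun y => ∃ z, p'.evalEval y z = 0 ∧ q'.evalEval y z = 0 ∧
      r'.evalEval y z = 0 with hs₁
    set s₂ := s.filter fun y => ∃ z, g.evalEval y z = 0 with hs₂
    have hsub : s ⊆ s₁ ∪ s₂ := by
      intro y hy
      obtain ⟨-, z, h1, h2, h3⟩ := hs y hy
      simp only [evalEval_mul, mul_eq_zero] at h1 h2 h3
      simp only [hs₁, hs₂, Finset.mem_union, Finset.mem_filter]
      by_cases hgz : g.evalEval y z = 0
      · exact Or.inr ⟨hy, z, hgz⟩
      · exact Or.inl ⟨hy, z, h1.resolve_left hgz, h2.resolve_left hgz, h3.resolve_left hgz⟩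
    have hc := (Finset.card_le_card hsub).trans (Finset.card_union_le _ _)
    have hc₁ : s₁.card + p'.natDegree ≤ p'.natDegree ^ 2 + 1 := by
      refine ih _ (by omega) p' q' r' hp' rfl (by omega) (bidegree_le_of_mul hgm.ne_zero hle hqd)
        (bidegree_le_of_mul hgm.ne_zero hle hrd) h' ?_ (hfin.subset ?_) s₁ ?_
      · intro h0
        rw [mul_coeff_zero, mul_coeff_zero, h0, mul_zero] at hq0
        exact hq0 rfl
      · rintro v ⟨h1, h2, h3⟩
        simp [h1, h2, h3]
      · intro y hy
        rw [hs₁, Finset.mem_filter] at hy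
        exact ⟨(hs y hy.1).1, hy.2⟩
    have hc₂ : s₂.card ≤ g.natDegree ^ 2 := by
      refine card_le_sq_of_irreducible_of_finite hgm hg (by omega) (hfin.subset ?_) s₂ ?_
      · intro v hv
        rw [Set.mem_ofPred_eq] at hv
        simp [hv]
      · intro y hy
        rw [hs₂, Finset.mem_filter] at hy
        exact hy.2
    rw [← hpn]
    have : 1 ≤ p'.natDegree := Nat.one_le_iff_ne_zero.2 hn'
    nlinarith [Nat.mul_le_mul_left g.natDegree this]
  · obtain ⟨t, ht⟩ := X_pow_dvd_resultant hn hpn.le ((natDegree_le_bidegree q).trans hqd) hrn h hq0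
    have hdeg : (p.resultant r n (n - 1)).natDegree ≤ n ^ 2 := by
      refine natDegree_resultant_le _ _ _ _ n _ ?_ ?_ ?_
      · exact fun k hk => (natDegree_coeff_add_le_bidegree p k hk).trans hpd
      · exact fun k hk => (natDegree_coeff_add_le_bidegree r k hk).trans hrd
      · obtain ⟨d, rfl⟩ := Nat.exists_eq_succ_of_ne_zero hn
        rw [Nat.succ_sub_one]
        nlinarith
    have ht0 : t ≠ 0 := by
      rintro rfl
      exact hres (by rw [ht, mul_zero])
    rw [ht, natDegree_mul (pow_ne_zero _ X_ne_zero) ht0, natDegree_X_pow] at hdeg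
    have hcard : s.card ≤ t.natDegree := by
      refine card_le_natDegree_of_eval_eq_zero ht0 s fun y hy => ?_
      obtain ⟨hy0, z, h1, -, h3⟩ := hs y hy
      have := eval_resultant_eq_zero hpn.le hrn hn h1 h3
      rw [ht, eval_mul, eval_pow, eval_X] at this
      exact (mul_eq_zero.1 this).resolve_left (pow_ne_zero _ hy0)
    omega

theorem coeff_prod_sum_of_natDegree_le {R ι : Type*} [CommRing R] (s : Finset ι) (f : ι → R[X])
    (d : ι → ℕ) (h : ∀ i ∈ s, (f i).natDegree ≤ d i) :
    (∏ i ∈ s, f i).coeff (∑ i ∈ s, d i) = ∏ i ∈ s, (f i).coeff (d i) := by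
  classical
  induction s using Finset.induction_on with
  | empty => simp
  | insert i s hi ih =>
    rw [Finset.prod_insert hi, Finset.sum_insert hi, Finset.prod_insert hi,
      coeff_mul_add_eq_of_natDegree_le (h i (Finset.mem_insert_self i s)),
      ih fun j hj => h j (Finset.mem_insert_of_mem hj)]
    exact (natDegree_prod_le _ _).trans
      (Finset.sum_le_sum fun j hj => h j (Finset.mem_insert_of_mem hj))

end Polynomial

namespace MvPolynomial

open scoped Polynomial

theorem coeff_aeval_linear {R σ : Type*} [CommRing R] {P : MvPolynomial σ R} {n : ℕ}
    (hP : P.IsHomogeneous n) (a b : σ → R) :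
    (aeval (fun i => Polynomial.C (a i) + Polynomial.X * Polynomial.C (b i)) P).coeff n =
      eval b P := by
  rw [aeval_def, eval₂_eq, eval_eq, Polynomial.finsetSum_coeff]
  refine Finset.sum_congr rfl fun d hd => ?_
  rw [Polynomial.algebraMap_eq, Polynomial.coeff_C_mul]
  congr 1
  have hdeg : ∑ i ∈ d.support, d i = n := by
    rw [hP.degree_eq_sum_deg_support hd]
  have hlin : ∀ i, (Polynomial.C (a i) + Polynomial.X * Polynomial.C (b i)).natDegree ≤ 1 :=
    fun i => by compute_degree
  rw [← hdeg, Polynomial.coeff_prod_sum_of_natDegree_le _ _ d]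
  · refine Finset.prod_congr rfl fun i _ => ?_
    have := Polynomial.coeff_pow_of_natDegree_le (m := d i) (hlin i)
    rw [mul_one] at this
    rw [this]
    simp
  · exact fun i _ => Polynomial.natDegree_pow_le_of_le (d i) (hlin i) |>.trans (by simp)

/-- The restriction of a polynomial to the affine plane parametrized by `a + y b + z c`. -/
noncomputable def restrictPlane {σ : Type*} (a b c : σ → ℝ) : MvPolynomial σ ℝ →+* ℝ[X][X] :=
  eval₂Hom (Polynomial.C.comp Polynomial.C) fun i =>
    Polynomial.C (Polynomial.C (a i) + Polynomial.X * Polynomial.C (b i)) +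
      Polynomial.X * Polynomial.C (Polynomial.C (c i))

variable {σ : Type*} (a b c : σ → ℝ)

theorem evalEval_restrictPlane (P : MvPolynomial σ ℝ) (y z : ℝ) :
    (restrictPlane a b c P).evalEval y z = eval (a + y • b + z • c) P := by
  rw [← Polynomial.coe_evalEvalRingHom, restrictPlane, coe_eval₂Hom, hom_eval₂, eval, coe_eval₂Hom]
  congr 1
  · ext x
    simp
  · ext i
    simp
    ring

theorem restrictPlane_eq_aeval (P : MvPolynomial σ ℝ) :
    restrictPlane a b c P = aeval (fun i =>
      Polynomial.C (Polynomial.C (a i) + Polynomial.X * Polynomial.C (b i)) +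
        Polynomial.X * Polynomial.C (Polynomial.C (c i))) (map Polynomial.C P) := by
  rw [restrictPlane, coe_eval₂Hom, aeval_def, eval₂_map]
  rfl

theorem bidegree_restrictPlane_le {P : MvPolynomial σ ℝ} {n : ℕ} (hP : P.IsHomogeneous n) :
    (restrictPlane a b c P).bidegree ≤ n := by
  have : Polynomial.gradingHom ℝ (restrictPlane a b c P) = aeval (fun i =>
      Polynomial.C (Polynomial.C (a i)) + Polynomial.X * Polynomial.C (Polynomial.C (b i) +
        Polynomial.X * Polynomial.C (c i))) (map Polynomial.C P) := by
    rw [restrictPlane, coe_eval₂Hom, hom_eval₂, aeval_def, eval₂_map]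
    congr 1
    · ext x
      simp [Polynomial.gradingHom]
    · ext1 i
      simp [Polynomial.gradingHom]
      ring
  rw [Polynomial.bidegree, this]
  refine (aeval_natDegree_le (n := 1) _ (hP.map Polynomial.C).totalDegree_le _ fun i => ?_).trans
    (mul_one n).le
  compute_degree

theorem coeff_restrictPlane {P : MvPolynomial σ ℝ} {n : ℕ} (hP : P.IsHomogeneous n) :
    (restrictPlane a b c P).coeff n = Polynomial.C (eval c P) := by
  rw [restrictPlane_eq_aeval, coeff_aeval_linear (hP.map Polynomial.C), eval_map, eval₂_comp]
  rfl

theorem coeff_zero_restrictPlane (P : MvPolynomial σ ℝ) :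
    ((restrictPlane a b c P).coeff 0).coeff 0 = eval a P := by
  have := evalEval_restrictPlane a b c P 0 0
  rw [zero_smul, zero_smul, add_zero, add_zero] at this
  rw [← this, Polynomial.evalEval, Polynomial.C_0, Polynomial.coeff_zero_eq_eval_zero,
    Polynomial.coeff_zero_eq_eval_zero]

theorem IsHomogeneous.eval_smul {P : MvPolynomial σ ℝ} {n : ℕ} (hP : P.IsHomogeneous n) (t : ℝ)
    (v : σ → ℝ) : eval (t • v) P = t ^ n * eval v P := by
  rw [eval_eq, eval_eq, Finset.mul_sum]
  refine Finset.sum_congr rfl fun d hd => ?_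
  have hdeg : ∑ i ∈ d.support, d i = n := by
    rw [hP.degree_eq_sum_deg_support hd]
  simp only [Pi.smul_apply, smul_eq_mul, mul_pow, Finset.prod_mul_distrib]
  rw [Finset.prod_pow_eq_pow_sum, hdeg]
  ring

theorem exists_eval_ne_zero_and_dotProduct_ne_zero [Fintype σ] {f : MvPolynomial σ ℝ} (hf : f ≠ 0)
    {T : Set (σ → ℝ)} (hT : T.Finite) (h0 : ∀ w ∈ T, w ≠ 0) :
    ∃ v, eval v f ≠ 0 ∧ ∀ w ∈ T, w ⬝ᵥ v ≠ 0 := by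
  classical
  let L : (σ → ℝ) → MvPolynomial σ ℝ := fun w => ∑ i, C (w i) * X i
  have hL : ∀ w v, eval v (L w) = w ⬝ᵥ v := fun w v => by simp [L, dotProduct]
  have hne : f * ∏ w ∈ hT.toFinset, L w ≠ 0 := by
    refine mul_ne_zero hf (Finset.prod_ne_zero_iff.2 fun w hw h => ?_)
    refine h0 w (hT.mem_toFinset.1 hw) (dotProduct_self_eq_zero.1 ?_)
    rw [← hL, h, map_zero]
  obtain ⟨v, hv⟩ : ∃ v, eval v (f * ∏ w ∈ hT.toFinset, L w) ≠ 0 := by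
    by_contra! hc
    exact hne (MvPolynomial.funext fun v => by rw [hc v, map_zero])
  rw [map_mul, map_prod, mul_ne_zero_iff, Finset.prod_ne_zero_iff] at hv
  exact ⟨v, hv.1, fun w hw => hL w v ▸ hv.2 w (hT.mem_toFinset.2 hw)⟩

end MvPolynomial

section CrossProduct

open scoped Matrix

theorem cross_dotProduct_smul_eq (a b c q : Fin 3 → ℝ) :
    ((c ⨯₃ a) ⬝ᵥ b) • q =
      ((c ⨯₃ q) ⬝ᵥ b) • a + (-((c ⨯₃ q) ⬝ᵥ a)) • b + ((a ⨯₃ b) ⬝ᵥ q) • c := by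
  ext i
  fin_cases i <;> simp [cross_apply, dotProduct, Fin.sum_univ_three] <;> ring

theorem cross_dotProduct_swap (a b c : Fin 3 → ℝ) : (a ⨯₃ b) ⬝ᵥ c = -((a ⨯₃ c) ⬝ᵥ b) := by
  simp [cross_apply, dotProduct, Fin.sum_univ_three]
  ring

theorem cross_dotProduct_rotate (a b c : Fin 3 → ℝ) : (a ⨯₃ b) ⬝ᵥ c = (c ⨯₃ a) ⬝ᵥ b := by
  simp [cross_apply, dotProduct, Fin.sum_univ_three]
  ring

theorem eq_zero_of_dotProduct_eq_zero {a b c u : Fin 3 → ℝ} (h : (c ⨯₃ a) ⬝ᵥ b ≠ 0)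
    (ha : a ⬝ᵥ u = 0) (hb : b ⬝ᵥ u = 0) (hc : c ⬝ᵥ u = 0) : u = 0 := by
  have : ((c ⨯₃ a) ⬝ᵥ b) • u = (a ⬝ᵥ u) • (b ⨯₃ c) + (b ⬝ᵥ u) • (c ⨯₃ a) +
      (c ⬝ᵥ u) • (a ⨯₃ b) := by
    ext i
    fin_cases i <;> simp [cross_apply, dotProduct, Fin.sum_univ_three] <;> ring
  rw [ha, hb, hc, zero_smul, zero_smul, zero_smul, add_zero, add_zero] at this
  exact (smul_eq_zero.1 this).resolve_left h

theorem cross_dotProduct_mul_sub (a b c q q' : Fin 3 → ℝ) :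
    (q ⨯₃ q') ⬝ᵥ c * ((c ⨯₃ a) ⬝ᵥ b) =
      (c ⨯₃ q) ⬝ᵥ a * ((c ⨯₃ q') ⬝ᵥ b) - (c ⨯₃ q') ⬝ᵥ a * ((c ⨯₃ q) ⬝ᵥ b) := by
  simp [cross_apply, dotProduct, Fin.sum_univ_three]
  ring

theorem eq_or_eq_neg_of_cross_eq_zero {q q' : Fin 3 → ℝ} (hq : q ⬝ᵥ q = 1) (hq' : q' ⬝ᵥ q' = 1)
    (h : q ⨯₃ q' = 0) : q' = q ∨ q' = -q := by
  have h1 := cross_dot_cross q q' q q'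
  rw [h, zero_dotProduct, hq, hq', dotProduct_comm q' q] at h1
  have h2 : (q' - (q ⬝ᵥ q') • q) ⬝ᵥ (q' - (q ⬝ᵥ q') • q) = 0 := by
    simp only [sub_dotProduct, dotProduct_sub, smul_dotProduct, dotProduct_smul, hq, hq',
      dotProduct_comm q' q, smul_eq_mul]
    linarith
  have h3 := sub_eq_zero.1 (dotProduct_self_eq_zero.1 h2)
  have h4 : (q ⬝ᵥ q' - 1) * (q ⬝ᵥ q' + 1) = 0 := by linarith
  rcases mul_eq_zero.1 h4 with h5 | h5
  · left
    rw [h3, sub_eq_zero.1 h5, one_smul]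
  · right
    rw [h3, eq_neg_of_add_eq_zero_left h5, neg_one_smul]

theorem exists_cross_single_ne_zero {q : Fin 3 → ℝ} (hq : q ≠ 0) :
    ∃ i, q ⨯₃ (Pi.single i 1) ≠ 0 := by
  by_contra! h
  apply hq
  have h0 := h 0
  have h1 := h 1
  simp [cross_apply] at h0 h1
  ext i
  fin_cases i <;> simp [h0, h1]

theorem exists_smul_dotProduct_self_eq_one {v : Fin 3 → ℝ} (hv : v ≠ 0) :
    ∃ t : ℝ, t ≠ 0 ∧ (t • v) ⬝ᵥ (t • v) = 1 := by
  have hpos : 0 < v ⬝ᵥ v := by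
    refine lt_of_le_of_ne (Finset.sum_nonneg fun i _ => mul_self_nonneg (v i)) fun h => ?_
    exact hv (dotProduct_self_eq_zero.1 h.symm)
  refine ⟨(√(v ⬝ᵥ v))⁻¹, inv_ne_zero (Real.sqrt_pos.2 hpos).ne', ?_⟩
  rw [smul_dotProduct, dotProduct_smul, smul_smul, smul_eq_mul, ← mul_inv,
    Real.mul_self_sqrt hpos.le, inv_mul_cancel₀ hpos.ne']

namespace MvPolynomial

/-- The value at `v` of the vector field with components `V`. -/
noncomputable def fieldAt (V : Fin 3 → MvPolynomial (Fin 3) ℝ) (v : Fin 3 → ℝ) : Fin 3 → ℝ :=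
  fun i => eval v (V i)

theorem fieldAt_smul {V : Fin 3 → MvPolynomial (Fin 3) ℝ} {n : ℕ}
    (hV : ∀ i, (V i).IsHomogeneous n) (t : ℝ) (v : Fin 3 → ℝ) :
    fieldAt V (t • v) = t ^ n • fieldAt V v := by
  ext i
  simp [fieldAt, (hV i).eval_smul]

theorem exists_generic_frame {V : Fin 3 → MvPolynomial (Fin 3) ℝ} {n : ℕ}
    (hV : ∀ i, (V i).IsHomogeneous n) (hV0 : ∃ i, V i ≠ 0) {S : Set (Fin 3 → ℝ)} (hS : S.Finite)
    (hne : S.Nonempty) (hS0 : ∀ q ∈ S, q ≠ 0) :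
    ∃ a b c : Fin 3 → ℝ, (c ⨯₃ a) ⬝ᵥ b ≠ 0 ∧ a ⬝ᵥ fieldAt V c = 1 ∧ b ⬝ᵥ fieldAt V a ≠ 0 ∧
      (∀ q ∈ S, (c ⨯₃ q) ⬝ᵥ a ≠ 0) ∧ (∀ q ∈ S, (c ⨯₃ q) ⬝ᵥ b ≠ 0) ∧
      ∀ q ∈ S, ∀ q' ∈ S, q ⨯₃ q' ≠ 0 → (q ⨯₃ q') ⬝ᵥ c ≠ 0 := by
  obtain ⟨k, hk⟩ := hV0
  obtain ⟨q₀, hq₀⟩ := hne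
  have hfield : ∀ v, eval v (V k) ≠ 0 → fieldAt V v ≠ 0 := fun v hv h => hv (congrFun h k)
  obtain ⟨c, hc, hcT⟩ := exists_eval_ne_zero_and_dotProduct_ne_zero hk
    (T := Set.image2 (fun q q' => q ⨯₃ q') S
      (S ∪ Set.range fun i : Fin 3 => (Pi.single i 1 : Fin 3 → ℝ)) \ {0})
    ((hS.image2 _ (hS.union (Set.finite_range _))).sdiff) (fun w hw => hw.2)
  have hcS : ∀ q ∈ S, c ⨯₃ q ≠ 0 := by
    intro q hq h
    obtain ⟨i, hi⟩ := exists_cross_single_ne_zero (hS0 q hq)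
    refine hcT _ ⟨⟨q, hq, _, Or.inr ⟨i, rfl⟩, rfl⟩, hi⟩ ?_
    rw [cross_dotProduct_rotate, h, zero_dotProduct]
  obtain ⟨a, ha, haT⟩ := exists_eval_ne_zero_and_dotProduct_ne_zero hk
    (T := insert (fieldAt V c) ((fun q => c ⨯₃ q) '' S)) ((hS.image _).insert _) (by
      rintro w (rfl | ⟨q, hq, rfl⟩)
      exacts [hfield c hc, hcS q hq])
  have hca : c ⨯₃ a ≠ 0 := by
    intro h
    refine haT _ (Set.mem_insert_of_mem _ ⟨q₀, hq₀, rfl⟩) ?_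
    rw [cross_dotProduct_swap, h, zero_dotProduct, neg_zero]
  set κ := fieldAt V c ⬝ᵥ a with hκ
  have hκ0 : κ ≠ 0 := haT _ (Set.mem_insert _ _)
  obtain ⟨b, -, hbT⟩ := exists_eval_ne_zero_and_dotProduct_ne_zero
    (one_ne_zero (α := MvPolynomial (Fin 3) ℝ))
    (T := insert (fieldAt V a) (insert (c ⨯₃ a) ((fun q => c ⨯₃ q) '' S)))
    (((hS.image _).insert _).insert _) (by
      rintro w (rfl | rfl | ⟨q, hq, rfl⟩)
      exacts [hfield a ha, hca, hcS q hq])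
  refine ⟨κ⁻¹ • a, b, c, ?_, ?_, ?_, ?_, ?_, ?_⟩
  · rw [map_smul, smul_dotProduct]
    exact smul_ne_zero (inv_ne_zero hκ0) (hbT _ (by simp))
  · rw [smul_dotProduct, dotProduct_comm, ← hκ, smul_eq_mul, inv_mul_cancel₀ hκ0]
  · rw [fieldAt_smul hV, dotProduct_smul, dotProduct_comm]
    exact smul_ne_zero (pow_ne_zero _ (inv_ne_zero hκ0)) (hbT _ (by simp))
  · intro q hq
    rw [dotProduct_smul]
    exact smul_ne_zero (inv_ne_zero hκ0) (haT _ (Set.mem_insert_of_mem _ ⟨q, hq, rfl⟩))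
  · exact fun q hq => hbT _ (Or.inr (Or.inr ⟨q, hq, rfl⟩))
  · exact fun q hq q' hq' h => hcT _ ⟨⟨q, hq, q', Or.inl hq', rfl⟩, h⟩

open scoped Polynomial in
theorem ncard_zeros_le {V : Fin 3 → MvPolynomial (Fin 3) ℝ} {n : ℕ}
    (hV : ∀ i, (V i).IsHomogeneous n) (hX : ∑ i, X i * V i = 0) (hV0 : ∃ i, V i ≠ 0)
    (hS : {q : Fin 3 → ℝ | q ⬝ᵥ q = 1 ∧ fieldAt V q = 0}.Finite) :
    {q : Fin 3 → ℝ | q ⬝ᵥ q = 1 ∧ fieldAt V q = 0}.ncard ≤ 2 * (n ^ 2 - n + 1) := by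
  classical
  set S := {q : Fin 3 → ℝ | q ⬝ᵥ q = 1 ∧ fieldAt V q = 0} with hSdef
  rcases S.eq_empty_or_nonempty with he | hne
  · simp [he]
  have hS0 : ∀ q ∈ S, q ≠ 0 := by
    rintro q hq rfl
    simpa using hq.1
  obtain ⟨a, b, c, hD, hac, hba, hSa, hSb, hSc⟩ := exists_generic_frame hV hV0 hS hne hS0
  let W : (Fin 3 → ℝ) → MvPolynomial (Fin 3) ℝ := fun u => ∑ i, C (u i) * V i
  have hW : ∀ u, (W u).IsHomogeneous n := fun u =>
    IsHomogeneous.sum _ _ _ fun i _ => (hV i).C_mul (u i)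
  have hWv : ∀ u v, eval v (W u) = u ⬝ᵥ fieldAt V v := fun u v => by
    simp [W, dotProduct, fieldAt]
  let f : (Fin 3 → ℝ) → ℝ[X][X] := fun u => restrictPlane a b c (W u)
  have hfv : ∀ u y z, (f u).evalEval y z = u ⬝ᵥ fieldAt V (a + y • b + z • c) := fun u y z => by
    rw [evalEval_restrictPlane, hWv]
  have hfb : ∀ u, (f u).bidegree ≤ n := fun u => bidegree_restrictPlane_le a b c (hW u)
  have hfd : (f a).natDegree ≤ n := (Polynomial.natDegree_le_bidegree _).trans (hfb a)
  have hfn : (f a).coeff n = 1 := by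
    rw [coeff_restrictPlane a b c (hW a), hWv, hac, Polynomial.C_1]
  have hrel : f a + Polynomial.C Polynomial.X * f b + Polynomial.X * f c = 0 := by
    have h := congrArg (restrictPlane a b c) hX
    rw [map_zero, map_sum] at h
    rw [← h]
    simp only [f, W, map_sum, map_mul, Finset.mul_sum, ← Finset.sum_add_distrib]
    refine Finset.sum_congr rfl fun i _ => ?_
    simp only [restrictPlane, coe_eval₂Hom, eval₂_X, eval₂_C, RingHom.comp_apply, map_add, map_mul]
    ring
  have hzero : ∀ y z, (f a).evalEval y z = 0 ∧ (f b).evalEval y z = 0 ∧ (f c).evalEval y z = 0 ↔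
      fieldAt V (a + y • b + z • c) = 0 := by
    intro y z
    rw [hfv, hfv, hfv]
    refine ⟨fun h => eq_zero_of_dotProduct_eq_zero hD h.1 h.2.1 h.2.2, fun h => ?_⟩
    simp [h]
  let Y : (Fin 3 → ℝ) → ℝ := fun q => -((c ⨯₃ q) ⬝ᵥ a) / ((c ⨯₃ q) ⬝ᵥ b)
  let Z : (Fin 3 → ℝ) → ℝ := fun q => ((a ⨯₃ b) ⬝ᵥ q) / ((c ⨯₃ q) ⬝ᵥ b)
  have hfin : {v : ℝ × ℝ | (f a).evalEval v.1 v.2 = 0 ∧ (f b).evalEval v.1 v.2 = 0 ∧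
      (f c).evalEval v.1 v.2 = 0}.Finite := by
    refine (hS.image fun q => (Y q, Z q)).subset ?_
    rintro ⟨y, z⟩ h
    have h := (hzero y z).1 h
    set w := a + y • b + z • c with hw
    have hcw : (c ⨯₃ w) ⬝ᵥ b = (c ⨯₃ a) ⬝ᵥ b := by
      rw [hw]
      simp [cross_apply, dotProduct, Fin.sum_univ_three]
      ring
    have hcw' : (c ⨯₃ w) ⬝ᵥ a = -(y * ((c ⨯₃ a) ⬝ᵥ b)) := by
      rw [hw]
      simp [cross_apply, dotProduct, Fin.sum_univ_three]
      ring
    have habw : (a ⨯₃ b) ⬝ᵥ w = z * ((c ⨯₃ a) ⬝ᵥ b) := by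
      rw [hw]
      simp [cross_apply, dotProduct, Fin.sum_univ_three]
      ring
    have hw0 : w ≠ 0 := by
      intro h0
      rw [h0, map_zero, zero_dotProduct] at hcw
      exact hD hcw.symm
    obtain ⟨t, ht, hts⟩ := exists_smul_dotProduct_self_eq_one hw0
    refine ⟨t • w, ⟨hts, by rw [fieldAt_smul hV, h, smul_zero]⟩, ?_⟩
    simp only [Y, Z, map_smul, smul_dotProduct, dotProduct_smul, hcw, hcw', habw, smul_eq_mul,
      Prod.mk.injEq]
    constructor <;> field_simp
  have hcard := Polynomial.card_add_le_sq_add_one n (f a) (f b) (f c)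
    (Polynomial.monic_of_natDegree_le_of_coeff_eq_one n hfd hfn)
    (Polynomial.natDegree_eq_of_le_of_coeff_ne_zero hfd (by simp [hfn])) (hfb a) (hfb b) (hfb c) hrel
    (by rwa [coeff_zero_restrictPlane, hWv]) hfin (hS.toFinset.image Y) (by
      simp only [Finset.mem_image, Set.Finite.mem_toFinset]
      rintro _ ⟨q, hq, rfl⟩
      refine ⟨div_ne_zero (neg_ne_zero.2 (hSa q hq)) (hSb q hq), Z q, (hzero _ _).2 ?_⟩
      have : a + Y q • b + Z q • c = (((c ⨯₃ a) ⬝ᵥ b) / ((c ⨯₃ q) ⬝ᵥ b)) • q := by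
        rw [div_eq_inv_mul, mul_smul, cross_dotProduct_smul_eq a b c q, smul_add, smul_add,
          inv_smul_smul₀ (hSb q hq), smul_smul, smul_smul, ← div_eq_inv_mul, ← div_eq_inv_mul]
      rw [this, fieldAt_smul hV, hq.2, smul_zero])
  have hfib : hS.toFinset.card ≤ 2 * (hS.toFinset.image Y).card := by
    refine Finset.card_le_mul_card_image _ 2 fun y hy => ?_
    obtain ⟨q, hq, rfl⟩ := Finset.mem_image.1 hy
    refine (Finset.card_le_card (t := {q, -q}) fun q' hq' => ?_).trans Finset.card_le_two
    obtain ⟨hq', hY⟩ := Finset.mem_filter.1 hq'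
    rw [hS.mem_toFinset] at hq hq'
    have hcross : q ⨯₃ q' = 0 := by
      by_contra h
      refine hSc q hq q' hq' h ((mul_eq_zero.1 ?_).resolve_right hD)
      rw [cross_dotProduct_mul_sub]
      rw [div_eq_div_iff (hSb q' hq') (hSb q hq)] at hY
      linarith
    simpa using eq_or_eq_neg_of_cross_eq_zero hq.1 hq'.1 hcross
  rw [Set.ncard_eq_toFinset_card _ hS]
  have hn : n ≤ n ^ 2 := Nat.le_self_pow two_ne_zero n
  omega

end MvPolynomial

end CrossProduct

/-- A homogeneous polynomial vector field `X = (P,Q,R)` on `S²` of degree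
`n` with finitely many singularities on `S²` has at most `2(n²-n+1)` singularities on `S²`. -/
theorem stmt11 (n : ℕ) (P Q R : MvPolynomial (Fin 3) ℝ)
    (hP : P.IsHomogeneous n) (hQ : Q.IsHomogeneous n) (hR : R.IsHomogeneous n)
    (htan : ∀ p : Fin 3 → ℝ, p ∈ S2 →
      p 0 * eval p P + p 1 * eval p Q + p 2 * eval p R = 0)
    (hfin : {p ∈ S2 | eval p P = 0 ∧ eval p Q = 0 ∧ eval p R = 0}.Finite) :
    {p ∈ S2 | eval p P = 0 ∧ eval p Q = 0 ∧ eval p R = 0}.ncard ≤ 2 * (n ^ 2 - n + 1) := by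
  have hV : ∀ i, (![P, Q, R] i).IsHomogeneous n := by
    intro i
    fin_cases i <;> assumption
  have hmem : ∀ q : Fin 3 → ℝ, q ∈ S2 ↔ dotProduct q q = 1 := by
    intro q
    simp [S2, dotProduct, Fin.sum_univ_three, pow_two]
  have hset : {p ∈ S2 | eval p P = 0 ∧ eval p Q = 0 ∧ eval p R = 0} =
      {q : Fin 3 → ℝ | dotProduct q q = 1 ∧ fieldAt ![P, Q, R] q = 0} := by
    ext q
    simp [hmem, fieldAt, funext_iff, Fin.forall_fin_succ]
  rw [hset] at hfin ⊢
  refine ncard_zeros_le hV ?_ ?_ hfin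
  · refine MvPolynomial.funext fun v => ?_
    rcases eq_or_ne v 0 with rfl | hv
    · simp
    obtain ⟨t, ht, hts⟩ := exists_smul_dotProduct_self_eq_one hv
    have h := htan _ ((hmem _).2 hts)
    rw [hP.eval_smul, hQ.eval_smul, hR.eval_smul] at h
    simp only [Pi.smul_apply, smul_eq_mul] at h
    rw [map_zero, Fin.sum_univ_three]
    refine (mul_eq_zero.1 ?_).resolve_left (pow_ne_zero (n + 1) ht)
    simp only [Matrix.cons_val, map_add, map_mul, eval_X]
    linear_combination h
  · by_contra! h
    refine Set.infinite_of_injOn_mapsTo (f := fun t : ℝ => ![t, √(1 - t ^ 2), 0]) ?_ ?_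
      (Set.Icc_infinite (zero_lt_one' ℝ)) hfin
    · exact fun t _ t' _ htt' => congrFun htt' 0
    · intro t ht
      refine ⟨?_, _root_.funext fun i => by simp [fieldAt, h i]⟩
      have : 0 ≤ 1 - t ^ 2 := by nlinarith [ht.1, ht.2]
      simp [dotProduct, Fin.sum_univ_three, Real.mul_self_sqrt this]
      ring
end
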